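/- There exists c₄∈(0,+∞) such that for each ε∈(0,1), all g₁,g₂∈Γ_ε and all w∈W_*: |log ℋ_Γ(g₁M_w) − log ℋ_Γ(g₂M_w)| ≤ c₄·ε^{1−45d}·ρ_Γ(g₁,g₂). -/

import Mathlib

open MeasureTheory Filter Topology Matrix
open scoped ENNReal NNReal BigOperators

noncomputable section

/-- `D` is an open (round) disk in `ℂ`. -/
def IsOpenDisk (D : Set ℂ) : Prop := ∃ z : ℂ, ∃ r : ℝ, 0 < r ∧ D = Metric.ball z r

/-- `D` is an open half-plane in `ℂ`. -/
def IsOpenHalfPlane (D : Set ℂ) : Prop :=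
  ∃ a : ℂ, a ≠ 0 ∧ ∃ c : ℝ, D = {z : ℂ | (a * z).re < c}

/-- The center of an open disk (junk value otherwise). -/
noncomputable def diskCenter (D : Set ℂ) : ℂ :=
  Classical.epsilon fun z : ℂ => ∃ r : ℝ, 0 < r ∧ D = Metric.ball z r

/-- The radius of an open disk (junk value otherwise). -/
noncomputable def diskRadius (D : Set ℂ) : ℝ :=
  Classical.epsilon fun r : ℝ => 0 < r ∧ ∃ z : ℂ, D = Metric.ball z r

/-- The curvature of `D`: the reciprocal of the radius for an open disk,
and `0` for a half-plane (or anything that is not an open disk). -/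
noncomputable def curv (D : Set ℂ) : ℝ :=
  haveI := Classical.propDecidable (IsOpenDisk D)
  if IsOpenDisk D then (diskRadius D)⁻¹ else 0

/-- A tangential disk triple: each member is an open disk or an open half-plane
(at most one half-plane), and the closures of distinct members meet in exactly one point. -/
def IsTDT (𝒟 : Fin 3 → Set ℂ) : Prop :=
  ((∀ j, IsOpenDisk (𝒟 j)) ∨
    (∃ j, IsOpenHalfPlane (𝒟 j) ∧ ∀ k, k ≠ j → IsOpenDisk (𝒟 k))) ∧
  ∀ j k, j ≠ k → ∃ p : ℂ, closure (𝒟 j) ∩ closure (𝒟 k) = {p}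

/-- The ideal triangle `T(𝒟)`: the unique bounded connected component of
`ℂ ∖ (closure D₁ ∪ closure D₂ ∪ closure D₃)`. -/
noncomputable def idealTriangle (𝒟 : Fin 3 → Set ℂ) : Set ℂ :=
  Classical.epsilon fun T : Set ℂ =>
    Bornology.IsBounded T ∧
    ∃ z ∈ (⋃ j, closure (𝒟 j))ᶜ, T = connectedComponentIn (⋃ j, closure (𝒟 j))ᶜ z

/-- `q_j(𝒟)`: the tangency point of the two members other than the `j`-th one. -/
noncomputable def tangencyPoint (𝒟 : Fin 3 → Set ℂ) (j : Fin 3) : ℂ :=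
  Classical.epsilon fun p : ℂ => closure (𝒟 (j + 1)) ∩ closure (𝒟 (j + 2)) = {p}

/-- `𝒟` is a positively oriented tangential disk triple: the tangency points
`q₁(𝒟), q₂(𝒟), q₃(𝒟)` occur in counterclockwise order, i.e. the ideal triangle
lies to the left of its boundary oriented through `q₁(𝒟), q₂(𝒟), q₃(𝒟)` in this order. -/
def IsTDTplus (𝒟 : Fin 3 → Set ℂ) : Prop :=
  IsTDT 𝒟 ∧
  0 < ((tangencyPoint 𝒟 1 - tangencyPoint 𝒟 0).re *
        (tangencyPoint 𝒟 2 - tangencyPoint 𝒟 0).im -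
       (tangencyPoint 𝒟 1 - tangencyPoint 𝒟 0).im *
        (tangencyPoint 𝒟 2 - tangencyPoint 𝒟 0).re)

/-- `D` is an inscribed disk of the ideal triangle of `𝒟`. -/
def IsInscribedDisk (𝒟 : Fin 3 → Set ℂ) (D : Set ℂ) : Prop :=
  IsOpenDisk D ∧ D ⊆ idealTriangle 𝒟 ∧ ∀ j, ∃ p : ℂ, closure D ∩ closure (𝒟 j) = {p}

/-- The inscribed disk `D_in(𝒟)` of the ideal triangle of `𝒟`. -/
noncomputable def Din (𝒟 : Fin 3 → Set ℂ) : Set ℂ := Classical.epsilon (IsInscribedDisk 𝒟)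

/-- `Φ_j(𝒟)`: replace the `j`-th entry of `𝒟` by the inscribed disk `D_in(𝒟)`. -/
noncomputable def Phi (j : Fin 3) (𝒟 : Fin 3 → Set ℂ) : Fin 3 → Set ℂ :=
  Function.update 𝒟 j (Din 𝒟)

/-- Finite words over the alphabet `{1,2,3}` (represented by `Fin 3`). -/
abbrev Word := List (Fin 3)

/-- `𝒟_w = Φ_w(𝒟) = (Φ_{w_m} ∘ ⋯ ∘ Φ_{w_1})(𝒟)`. -/
noncomputable def applyWord (𝒟 : Fin 3 → Set ℂ) (w : Word) : Fin 3 → Set ℂ :=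
  w.foldl (fun D j => Phi j D) 𝒟

/-- The Apollonian gasket `K(𝒟)` associated with `𝒟`. -/
noncomputable def AG (𝒟 : Fin 3 → Set ℂ) : Set ℂ :=
  closure (idealTriangle 𝒟) \ ⋃ w : Word, Din (applyWord 𝒟 w)

/-- A concrete positively oriented tangential disk triple. -/
noncomputable def baseTriple : Fin 3 → Set ℂ :=
  ![{z : ℂ | 1 < z.im},
    Metric.ball (Complex.I / 2 - 1 / 2) (1 / 2),
    Metric.ball (Complex.I / 2 + 1 / 2) (1 / 2)]

/-- `d`, the Hausdorff dimension of the Apollonian gasket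
(independent of the choice of `𝒟 ∈ TDT⁺`). -/
noncomputable def dAG : ℝ := (dimH (AG baseTriple)).toReal

/-- The matrices `M₁, M₂, M₃`. -/
def Mmat : Fin 3 → Matrix (Fin 4) (Fin 4) ℝ :=
  ![!![1,0,0,0; 1,1,0,1; 1,0,1,1; 2,0,0,1],
    !![1,1,0,1; 0,1,0,0; 0,1,1,1; 0,2,0,1],
    !![1,0,1,1; 0,1,1,1; 0,0,1,0; 0,0,2,1]]

/-- `M_w := M_{w₁} ⋯ M_{w_m}` (`M_∅` is the identity matrix). -/
def Mword (w : Word) : Matrix (Fin 4) (Fin 4) ℝ := (w.map Mmat).prod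

/-- `κ(α,β,γ) := √(βγ + γα + αβ)`. -/
noncomputable def kappa (α β γ : ℝ) : ℝ := Real.sqrt (β * γ + γ * α + α * β)

/-- The row vector `(curv D₁, curv D₂, curv D₃, κ(𝒟))`. -/
noncomputable def curvVec (𝒟 : Fin 3 → Set ℂ) : Fin 4 → ℝ :=
  ![curv (𝒟 0), curv (𝒟 1), curv (𝒟 2),
    kappa (curv (𝒟 0)) (curv (𝒟 1)) (curv (𝒟 2))]

/-- The parameter space `Γ = {(g, κ(g)) : g ∈ [0,∞)³, κ(g) > 0} ⊆ [0,∞)⁴`. -/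
def Gamma : Set (Fin 4 → ℝ) :=
  {g | 0 ≤ g 0 ∧ 0 ≤ g 1 ∧ 0 ≤ g 2 ∧ g 3 = kappa (g 0) (g 1) (g 2) ∧ 0 < g 3}

/-- `Γ° := Γ ∩ (0,∞)⁴`. -/
def GammaInt : Set (Fin 4 → ℝ) := {g | g ∈ Gamma ∧ ∀ i, 0 < g i}

/-- The compact subset `Γ_ε` of `Γ`. -/
def GammaEps (ε : ℝ) : Set (Fin 4 → ℝ) :=
  {g | g 0 ∈ Set.Icc 0 ε⁻¹ ∧ g 1 ∈ Set.Icc 0 ε⁻¹ ∧ g 2 ∈ Set.Icc 0 ε⁻¹ ∧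
       g 3 = kappa (g 0) (g 1) (g 2) ∧
       ε ≤ g 1 + g 2 ∧ ε ≤ g 2 + g 0 ∧ ε ≤ g 0 + g 1}

/-- The Euclidean norm on `ℝ⁴`. -/
noncomputable def euclNorm4 (g : Fin 4 → ℝ) : ℝ := Real.sqrt (∑ i, g i ^ 2)

/-- The metric `ρ_Γ` on `Γ`: the Euclidean distance of the first three coordinates. -/
noncomputable def rhoGamma (g₁ g₂ : Fin 4 → ℝ) : ℝ :=
  Real.sqrt ((g₁ 0 - g₂ 0) ^ 2 + (g₁ 1 - g₂ 1) ^ 2 + (g₁ 2 - g₂ 2) ^ 2)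

/-- A positively oriented tangential disk triple with prescribed curvatures
`(g 0, g 1, g 2)` (junk value if none exists). -/
noncomputable def tripleOf (g : Fin 4 → ℝ) : Fin 3 → Set ℂ :=
  Classical.epsilon fun 𝒟 : Fin 3 → Set ℂ =>
    IsTDTplus 𝒟 ∧ curv (𝒟 0) = g 0 ∧ curv (𝒟 1) = g 1 ∧ curv (𝒟 2) = g 2

/-- `ℋ_Γ(g)`: the `d`-dimensional Hausdorff measure of the Apollonian gasket `K(𝒟)`
for any `𝒟 ∈ TDT⁺` whose members have curvatures `(g 0, g 1, g 2)`. -/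
noncomputable def HGamma (g : Fin 4 → ℝ) : ℝ :=
  (μH[dAG] (AG (tripleOf g))).toReal

/-- The operator norm of a `4 × 4` real matrix with respect to the Euclidean norm on `ℝ⁴`. -/
noncomputable def opNorm4 (M : Matrix (Fin 4) (Fin 4) ℝ) : ℝ :=
  sSup {t : ℝ | ∃ v : Fin 4 → ℝ, euclNorm4 v ≤ 1 ∧ t = euclNorm4 (M.mulVec v)}

/-- The set of words `I = {jⁿk : j,k ∈ S, j ≠ k, n ∈ ℕ}`. -/
def IdxI : Set Word :=
  {w | ∃ j k : Fin 3, j ≠ k ∧ ∃ n : ℕ, 0 < n ∧ w = List.replicate n j ++ [k]}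

end


/-- The open generalized disk `{v | a|v - A|² + 2 Re (b * conj (v - A)) + c < 0}`. -/
def gdisk (A : ℂ) (a : ℝ) (b : ℂ) (c : ℝ) : Set ℂ :=
  {v | a * Complex.normSq (v - A) + 2 * (b * (starRingEnd ℂ) (v - A)).re + c < 0}

/-- The closed generalized disk with the same coefficients. -/
def closedGdisk (A : ℂ) (a : ℝ) (b : ℂ) (c : ℝ) : Set ℂ :=
  {v | a * Complex.normSq (v - A) + 2 * (b * (starRingEnd ℂ) (v - A)).re + c ≤ 0}

theorem mem_gdisk (A : ℂ) (a : ℝ) (b : ℂ) (c : ℝ) (v : ℂ) : v ∈ gdisk A a b c ↔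
    a * Complex.normSq (v - A) + 2 * (b * (starRingEnd ℂ) (v - A)).re + c < 0 := Iff.rfl

theorem mem_closedGdisk (A : ℂ) (a : ℝ) (b : ℂ) (c : ℝ) (v : ℂ) : v ∈ closedGdisk A a b c ↔
    a * Complex.normSq (v - A) + 2 * (b * (starRingEnd ℂ) (v - A)).re + c ≤ 0 := Iff.rfl

theorem mem_ball_iff_normSq {v z : ℂ} {r : ℝ} (hr : 0 < r) :
    v ∈ Metric.ball z r ↔ Complex.normSq (v - z) < r ^ 2 := by
  rw [Metric.mem_ball, dist_eq_norm, Complex.normSq_eq_norm_sq,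
    pow_lt_pow_iff_left₀ (norm_nonneg _) hr.le two_ne_zero]

theorem mem_closedBall_iff_normSq {v z : ℂ} {r : ℝ} (hr : 0 < r) :
    v ∈ Metric.closedBall z r ↔ Complex.normSq (v - z) ≤ r ^ 2 := by
  rw [Metric.mem_closedBall, dist_eq_norm, Complex.normSq_eq_norm_sq,
    pow_le_pow_iff_left₀ (norm_nonneg _) hr.le two_ne_zero]

theorem gdisk_form_eq (A : ℂ) {a : ℝ} (ha : a ≠ 0) (b : ℂ) (c : ℝ) (v : ℂ) :
    a * Complex.normSq (v - A) + 2 * (b * (starRingEnd ℂ) (v - A)).re + c =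
      a * (Complex.normSq (v - (A - b / a)) - (Complex.normSq b - a * c) / a ^ 2) := by
  have h1 : (b / (a : ℂ)).re = b.re / a := by simp
  have h2 : (b / (a : ℂ)).im = b.im / a := by simp
  simp only [Complex.normSq_apply, Complex.sub_re, Complex.sub_im, Complex.mul_re,
    Complex.conj_re, Complex.conj_im, h1, h2]
  field_simp
  ring

theorem gdisk_eq_ball (A : ℂ) {a s : ℝ} (ha : 0 < a) (hs : 0 < s) {b : ℂ} {c : ℝ}
    (h : Complex.normSq b - a * c = s ^ 2) :
    gdisk A a b c = Metric.ball (A - b / a) (s / a) := by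
  ext v
  rw [mem_ball_iff_normSq (div_pos hs ha)]
  simp only [gdisk, Set.mem_ofPred_eq]
  rw [gdisk_form_eq A ha.ne', h, div_pow, mul_neg_iff]
  constructor
  · rintro (⟨-, h⟩ | ⟨h, -⟩) <;> linarith
  · intro h; exact Or.inl ⟨ha, by linarith⟩

theorem closedGdisk_eq_closedBall (A : ℂ) {a s : ℝ} (ha : 0 < a) (hs : 0 < s) {b : ℂ} {c : ℝ}
    (h : Complex.normSq b - a * c = s ^ 2) :
    closedGdisk A a b c = Metric.closedBall (A - b / a) (s / a) := by
  ext v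
  rw [mem_closedBall_iff_normSq (div_pos hs ha)]
  simp only [closedGdisk, Set.mem_ofPred_eq]
  rw [gdisk_form_eq A ha.ne', h, div_pow]
  constructor
  · intro h; by_contra! h2; nlinarith
  · intro h; nlinarith

theorem gdisk_zero_eq (A b : ℂ) (c : ℝ) :
    gdisk A 0 b c = {z | (2 * (starRingEnd ℂ) b * z).re <
      2 * (b * (starRingEnd ℂ) A).re - c} := by
  ext v
  simp only [gdisk, Set.mem_ofPred_eq, Complex.sub_re, Complex.sub_im, Complex.mul_re,
    Complex.conj_re, Complex.conj_im, Complex.mul_im, Complex.re_ofNat, Complex.im_ofNat]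
  constructor <;> intro h <;> linarith

theorem isOpenHalfPlane_gdisk_zero (A : ℂ) {b : ℂ} (hb : b ≠ 0) (c : ℝ) :
    IsOpenHalfPlane (gdisk A 0 b c) :=
  ⟨2 * (starRingEnd ℂ) b, by simpa using hb, _, gdisk_zero_eq A b c⟩

theorem ball_eq_ball_iff {z z' : ℂ} {r r' : ℝ} (hr : 0 < r) (hr' : 0 < r')
    (h : Metric.ball z r = Metric.ball z' r') : r = r' := by
  have h1 := congrArg Metric.diam h
  rw [Metric.diam_ball_eq _ hr.le, Metric.diam_ball_eq _ hr'.le] at h1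
  linarith

theorem curv_ball (z : ℂ) {r : ℝ} (hr : 0 < r) : curv (Metric.ball z r) = r⁻¹ := by
  have h1 : IsOpenDisk (Metric.ball z r) := ⟨z, r, hr, rfl⟩
  have h2 : 0 < diskRadius (Metric.ball z r) ∧
      ∃ z', Metric.ball z r = Metric.ball z' (diskRadius (Metric.ball z r)) :=
    Classical.epsilon_spec (p := fun s : ℝ => 0 < s ∧ ∃ z', Metric.ball z r = Metric.ball z' s)
      ⟨r, hr, z, rfl⟩
  obtain ⟨h3, z', h4⟩ := h2
  rw [curv, if_pos h1, ← ball_eq_ball_iff hr h3 h4]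

theorem not_isOpenDisk_of_isOpenHalfPlane {D : Set ℂ} (h : IsOpenHalfPlane D) :
    ¬ IsOpenDisk D := by
  rintro ⟨z, r, hr, rfl⟩
  obtain ⟨a, ha, c, h⟩ := h
  have hb : Bornology.IsBounded (Metric.ball z r) := Metric.isBounded_ball
  obtain ⟨R, hR⟩ := hb.exists_norm_le
  have ha' : 0 < ‖a‖ := norm_pos_iff.2 ha
  set t : ℝ := max (|c| + 1) (‖a‖ * (|R| + 1)) with ht
  have h1 : -(t : ℂ) / a ∈ Metric.ball z r := by
    rw [h, Set.mem_ofPred_eq, mul_div_cancel₀ _ ha]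
    simp only [Complex.neg_re, Complex.ofReal_re]
    have := le_max_left (|c| + 1) (‖a‖ * (|R| + 1))
    have := neg_abs_le c
    linarith
  have h2 := hR _ h1
  have h3 : ‖a‖ * (|R| + 1) ≤ t := le_max_right _ _
  have h4 : 0 < t := lt_of_lt_of_le (by positivity) h3
  rw [norm_div, norm_neg, Complex.norm_real, Real.norm_of_nonneg h4.le, div_le_iff₀ ha'] at h2
  nlinarith [le_abs_self R]

theorem curv_of_isOpenHalfPlane {D : Set ℂ} (h : IsOpenHalfPlane D) : curv D = 0 := by
  rw [curv, if_neg (not_isOpenDisk_of_isOpenHalfPlane h)]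

theorem isOpenDisk_gdisk (A : ℂ) {a s : ℝ} (ha : 0 < a) (hs : 0 < s) {b : ℂ} {c : ℝ}
    (h : Complex.normSq b - a * c = s ^ 2) : IsOpenDisk (gdisk A a b c) :=
  ⟨_, _, div_pos hs ha, gdisk_eq_ball A ha hs h⟩

theorem curv_gdisk (A : ℂ) {a s : ℝ} (ha : 0 ≤ a) (hs : 0 < s) {b : ℂ} {c : ℝ}
    (h : Complex.normSq b - a * c = s ^ 2) : curv (gdisk A a b c) = a / s := by
  rcases ha.eq_or_lt with rfl | ha
  · rw [curv_of_isOpenHalfPlane, zero_div]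
    apply isOpenHalfPlane_gdisk_zero
    rintro rfl
    simp at h
    exact (pow_pos hs 2).ne h
  · rw [gdisk_eq_ball A ha hs h, curv_ball _ (div_pos hs ha), inv_div]

theorem isOpen_gdisk (A : ℂ) (a : ℝ) (b : ℂ) (c : ℝ) : IsOpen (gdisk A a b c) := by
  apply isOpen_lt _ continuous_const
  have := Complex.continuous_normSq
  fun_prop

theorem closure_gdisk (A : ℂ) {a s : ℝ} (ha : 0 ≤ a) (hs : 0 < s) {b : ℂ} {c : ℝ}
    (h : Complex.normSq b - a * c = s ^ 2) :
    closure (gdisk A a b c) = closedGdisk A a b c := by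
  rcases ha.eq_or_lt with rfl | ha
  · apply Set.Subset.antisymm
    · apply closure_minimal
      · intro v hv
        exact le_of_lt ((mem_gdisk ..).1 hv)
      · apply isClosed_le _ continuous_const
        have := Complex.continuous_normSq
        fun_prop
    · intro v hv
      have hb : 0 < Complex.normSq b := by
        have : 0 < s ^ 2 := by positivity
        linarith
      have hlim : Tendsto (fun t : ℝ => v - (t : ℂ) * b) (𝓝[>] 0) (𝓝 v) := by
        have : ContinuousAt (fun t : ℝ => v - (t : ℂ) * b) 0 := by fun_prop
        have h2 := this.tendsto
        simp only [Complex.ofReal_zero, zero_mul, sub_zero] at h2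
        exact h2.mono_left nhdsWithin_le_nhds
      apply mem_closure_of_tendsto hlim
      filter_upwards [self_mem_nhdsWithin] with t ht
      simp only [closedGdisk, gdisk, Set.mem_ofPred_eq, Complex.normSq_apply, Complex.sub_re,
        Complex.sub_im, Complex.mul_re, Complex.mul_im, Complex.conj_re, Complex.conj_im,
        Complex.ofReal_re, Complex.ofReal_im] at hv hb ⊢
      have ht' : 0 < t := ht
      nlinarith [mul_pos ht' hb]
  · rw [gdisk_eq_ball A ha hs h, closure_ball _ (div_pos hs ha).ne',
      closedGdisk_eq_closedBall A ha hs h]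

/-- The Möbius map `z ↦ A + B / (z - p)`, which sends `∞` to `A` and `p` to `∞`. -/
noncomputable def mob (A B p z : ℂ) : ℂ := A + B / (z - p)

/-- The inverse of `mob A B p`. -/
noncomputable def mobInv (A B p v : ℂ) : ℂ := p + B / (v - A)

/-- The image under `mob A B p` of the triple consisting of the half-plane `{1 < im z}`,
the disk with center `i / 2` and radius `1 / 2`, and the half-plane `{im z < 0}`. -/
def stdTriple (A B p : ℂ) : Fin 3 → Set ℂ :=
  ![gdisk A (1 - p.im) (Complex.I * B / 2) 0,
    gdisk A (Complex.normSq p - p.im) (((starRingEnd ℂ) p + Complex.I / 2) * B) (Complex.normSq B),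
    gdisk A p.im (-(Complex.I * B / 2)) 0]

/-- The closures of the members of `stdTriple A B p`. -/
def closedStdTriple (A B p : ℂ) : Fin 3 → Set ℂ :=
  ![closedGdisk A (1 - p.im) (Complex.I * B / 2) 0,
    closedGdisk A (Complex.normSq p - p.im) (((starRingEnd ℂ) p + Complex.I / 2) * B)
      (Complex.normSq B),
    closedGdisk A p.im (-(Complex.I * B / 2)) 0]

/-- The poles for which the members of `stdTriple` have nonnegative curvature. -/
structure IsWeakPole (p : ℂ) : Prop where
  re_ne : p.re ≠ 0
  im_nonneg : 0 ≤ p.im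
  im_le_one : p.im ≤ 1
  im_le : p.im ≤ Complex.normSq p

/-- The poles of positive orientation. -/
structure IsPole (p : ℂ) : Prop extends IsWeakPole p where
  re_neg : p.re < 0

theorem mobInv_ne {B : ℂ} (A p : ℂ) {v : ℂ} (hB : B ≠ 0) (hv : v ≠ A) : mobInv A B p v ≠ p := by
  have : B / (v - A) ≠ 0 := div_ne_zero hB (sub_ne_zero.2 hv)
  simpa [mobInv] using this

theorem mob_mobInv {B : ℂ} (A p : ℂ) {v : ℂ} (hB : B ≠ 0) (hv : v ≠ A) :
    mob A B p (mobInv A B p v) = v := by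
  have := sub_ne_zero.2 hv
  rw [mob, mobInv, add_sub_cancel_left]
  field_simp
  ring

theorem mob_ne {B : ℂ} (A p : ℂ) {z : ℂ} (hB : B ≠ 0) (hz : z ≠ p) : mob A B p z ≠ A := by
  have : B / (z - p) ≠ 0 := div_ne_zero hB (sub_ne_zero.2 hz)
  simpa [mob] using this

theorem mobInv_mob {B : ℂ} (A p : ℂ) {z : ℂ} (hB : B ≠ 0) (hz : z ≠ p) :
    mobInv A B p (mob A B p z) = z := mob_mobInv p A hB hz

theorem mob_continuousAt {B : ℂ} (A p : ℂ) {z : ℂ} (hz : z ≠ p) :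
    ContinuousAt (mob A B p) z := by
  have := sub_ne_zero.2 hz
  unfold mob
  fun_prop (disch := assumption)

theorem mobInv_continuousAt {B : ℂ} (A p : ℂ) {v : ℂ} (hv : v ≠ A) :
    ContinuousAt (mobInv A B p) v := mob_continuousAt p A hv

theorem mob_sub_mob {B : ℂ} (A p : ℂ) {z w : ℂ} (hz : z ≠ p) (hw : w ≠ p) :
    mob A B p z - mob A B p w = B * (w - z) / ((z - p) * (w - p)) := by
  have := sub_ne_zero.2 hz
  have := sub_ne_zero.2 hw
  unfold mob
  field_simp
  ring

theorem mul_neg_iff_right_neg {a b : ℝ} (ha : 0 < a) : a * b < 0 ↔ b < 0 :=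
  ⟨fun h => by by_contra! hb; linarith [mul_nonneg ha.le hb], fun h => mul_neg_of_pos_of_neg ha h⟩

theorem normSq_pos_of_ne {z w : ℂ} (h : z ≠ w) : 0 < Complex.normSq (z - w) :=
  Complex.normSq_pos.2 (sub_ne_zero.2 h)

theorem mul_conj_div_re {B : ℂ} (b p : ℂ) {z : ℂ} (hz : z ≠ p) :
    (b * B * (starRingEnd ℂ) (B / (z - p))).re =
      Complex.normSq B / Complex.normSq (z - p) * (b * (z - p)).re := by
  have h0 := normSq_pos_of_ne hz
  have h1 : b * B * (starRingEnd ℂ) (B / (z - p)) =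
      ((Complex.normSq B / Complex.normSq (z - p) : ℝ) : ℂ) * (b * (z - p)) := by
    have h2 := sub_ne_zero.2 hz
    have h3 : (starRingEnd ℂ) (z - p) ≠ 0 := (map_ne_zero _).2 h2
    rw [map_div₀, Complex.ofReal_div, ← Complex.mul_conj, ← Complex.mul_conj]
    field_simp
  rw [h1, Complex.re_ofReal_mul]

theorem form_zero_mob {B : ℂ} (A p : ℂ) {z : ℂ} (hz : z ≠ p) :
    (1 - p.im) * Complex.normSq (mob A B p z - A) +
      2 * (Complex.I * B / 2 * (starRingEnd ℂ) (mob A B p z - A)).re + 0 =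
      Complex.normSq B / Complex.normSq (z - p) * (1 - z.im) := by
  have h0 := normSq_pos_of_ne hz
  have h1 := mul_conj_div_re (B := B) (Complex.I / 2) p hz
  rw [mob, add_sub_cancel_left, mul_div_right_comm, h1, Complex.normSq_div]
  have h2 : (Complex.I / 2 * (z - p)).re = (p.im - z.im) / 2 := by
    simp [Complex.mul_re]; ring
  rw [h2]
  field_simp
  ring

theorem form_two_mob {B : ℂ} (A p : ℂ) {z : ℂ} (hz : z ≠ p) :
    p.im * Complex.normSq (mob A B p z - A) +
      2 * (-(Complex.I * B / 2) * (starRingEnd ℂ) (mob A B p z - A)).re + 0 =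
      Complex.normSq B / Complex.normSq (z - p) * z.im := by
  have h0 := normSq_pos_of_ne hz
  have h1 := mul_conj_div_re (B := B) (-(Complex.I / 2)) p hz
  rw [mob, add_sub_cancel_left, mul_div_right_comm, ← neg_mul, h1, Complex.normSq_div]
  have h2 : (-(Complex.I / 2) * (z - p)).re = (z.im - p.im) / 2 := by
    simp [Complex.mul_re]; ring
  rw [h2]
  field_simp
  ring

theorem form_one_mob {B : ℂ} (A p : ℂ) {z : ℂ} (hz : z ≠ p) :
    (Complex.normSq p - p.im) * Complex.normSq (mob A B p z - A) +
      2 * (((starRingEnd ℂ) p + Complex.I / 2) * B * (starRingEnd ℂ) (mob A B p z - A)).re +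
        Complex.normSq B =
      Complex.normSq B / Complex.normSq (z - p) * (Complex.normSq z - z.im) := by
  have h0 := normSq_pos_of_ne hz
  have h1 := mul_conj_div_re (B := B) ((starRingEnd ℂ) p + Complex.I / 2) p hz
  rw [mob, add_sub_cancel_left, h1, Complex.normSq_div]
  have h2 : (((starRingEnd ℂ) p + Complex.I / 2) * (z - p)).re =
      (Complex.normSq z - Complex.normSq p - Complex.normSq (z - p)) / 2 + (p.im - z.im) / 2 := by
    simp [Complex.normSq_apply, Complex.mul_re]; ring
  rw [h2]
  field_simp
  ring

section

variable {A B p : ℂ}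

theorem form_coeff_pos (hB : B ≠ 0) {z : ℂ} (hz : z ≠ p) :
    0 < Complex.normSq B / Complex.normSq (z - p) :=
  div_pos (Complex.normSq_pos.2 hB) (normSq_pos_of_ne hz)

theorem mob_mem_stdTriple_zero (hB : B ≠ 0) {z : ℂ} (hz : z ≠ p) :
    mob A B p z ∈ stdTriple A B p 0 ↔ 1 < z.im := by
  rw [show stdTriple A B p 0 = gdisk A (1 - p.im) (Complex.I * B / 2) 0 from rfl, mem_gdisk,
    form_zero_mob A p hz, mul_neg_iff_right_neg (form_coeff_pos hB hz), sub_neg]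

theorem mob_mem_stdTriple_one (hB : B ≠ 0) {z : ℂ} (hz : z ≠ p) :
    mob A B p z ∈ stdTriple A B p 1 ↔ Complex.normSq z < z.im := by
  rw [show stdTriple A B p 1 = gdisk A (Complex.normSq p - p.im)
    (((starRingEnd ℂ) p + Complex.I / 2) * B) (Complex.normSq B) from rfl, mem_gdisk,
    form_one_mob A p hz, mul_neg_iff_right_neg (form_coeff_pos hB hz), sub_neg]

theorem mob_mem_stdTriple_two (hB : B ≠ 0) {z : ℂ} (hz : z ≠ p) :
    mob A B p z ∈ stdTriple A B p 2 ↔ z.im < 0 := by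
  rw [show stdTriple A B p 2 = gdisk A p.im (-(Complex.I * B / 2)) 0 from rfl, mem_gdisk,
    form_two_mob A p hz, mul_neg_iff_right_neg (form_coeff_pos hB hz)]

theorem mob_mem_closedStdTriple_zero (hB : B ≠ 0) {z : ℂ} (hz : z ≠ p) :
    mob A B p z ∈ closedStdTriple A B p 0 ↔ 1 ≤ z.im := by
  rw [show closedStdTriple A B p 0 = closedGdisk A (1 - p.im) (Complex.I * B / 2) 0 from rfl,
    mem_closedGdisk, form_zero_mob A p hz, mul_nonpos_iff_pos_imp_nonpos]
  have := form_coeff_pos hB hz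
  constructor
  · intro h; linarith [h.1 this]
  · intro h; exact ⟨fun _ => by linarith, fun _ => this.le⟩

theorem mob_mem_closedStdTriple_one (hB : B ≠ 0) {z : ℂ} (hz : z ≠ p) :
    mob A B p z ∈ closedStdTriple A B p 1 ↔ Complex.normSq z ≤ z.im := by
  rw [show closedStdTriple A B p 1 = closedGdisk A (Complex.normSq p - p.im)
    (((starRingEnd ℂ) p + Complex.I / 2) * B) (Complex.normSq B) from rfl, mem_closedGdisk,
    form_one_mob A p hz, mul_nonpos_iff_pos_imp_nonpos]
  have := form_coeff_pos hB hz
  constructor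
  · intro h; linarith [h.1 this]
  · intro h; exact ⟨fun _ => by linarith, fun _ => this.le⟩

theorem mob_mem_closedStdTriple_two (hB : B ≠ 0) {z : ℂ} (hz : z ≠ p) :
    mob A B p z ∈ closedStdTriple A B p 2 ↔ z.im ≤ 0 := by
  rw [show closedStdTriple A B p 2 = closedGdisk A p.im (-(Complex.I * B / 2)) 0 from rfl,
    mem_closedGdisk, form_two_mob A p hz, mul_nonpos_iff_pos_imp_nonpos]
  have := form_coeff_pos hB hz
  constructor
  · intro h; linarith [h.1 this]
  · intro h; exact ⟨fun _ => by linarith, fun _ => this.le⟩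

theorem self_mem_closedStdTriple_zero : A ∈ closedStdTriple A B p 0 := by
  simp [closedStdTriple, closedGdisk]

theorem self_mem_closedStdTriple_two : A ∈ closedStdTriple A B p 2 := by
  simp [closedStdTriple, closedGdisk]

theorem self_notMem_closedStdTriple_one (hB : B ≠ 0) : A ∉ closedStdTriple A B p 1 := by
  simpa [closedStdTriple, closedGdisk] using Complex.normSq_pos.2 hB

theorem norm_half_sq (B : ℂ) : (‖B‖ / 2) ^ 2 = Complex.normSq B / 4 := by
  rw [div_pow, Complex.normSq_eq_norm_sq]; norm_num

theorem stdTriple_disc_zero : Complex.normSq (Complex.I * B / 2) - (1 - p.im) * 0 =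
    (‖B‖ / 2) ^ 2 := by
  rw [norm_half_sq]; simp [Complex.normSq_mul]; norm_num

theorem stdTriple_disc_two : Complex.normSq (-(Complex.I * B / 2)) - p.im * 0 =
    (‖B‖ / 2) ^ 2 := by
  rw [norm_half_sq]; simp [Complex.normSq_mul]; norm_num

theorem stdTriple_disc_one : Complex.normSq (((starRingEnd ℂ) p + Complex.I / 2) * B) -
    (Complex.normSq p - p.im) * Complex.normSq B = (‖B‖ / 2) ^ 2 := by
  rw [norm_half_sq, Complex.normSq_mul]
  have : Complex.normSq ((starRingEnd ℂ) p + Complex.I / 2) =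
      Complex.normSq p - p.im + 1 / 4 := by
    simp [Complex.normSq_apply]; ring
  rw [this]; ring

theorem closure_stdTriple (hB : B ≠ 0) (hp : IsWeakPole p) (j : Fin 3) :
    closure (stdTriple A B p j) = closedStdTriple A B p j := by
  have hs : 0 < ‖B‖ / 2 := by have := norm_pos_iff.2 hB; positivity
  fin_cases j
  · exact closure_gdisk A (sub_nonneg.2 hp.im_le_one) hs stdTriple_disc_zero
  · exact closure_gdisk A (sub_nonneg.2 hp.im_le) hs stdTriple_disc_one
  · exact closure_gdisk A hp.im_nonneg hs stdTriple_disc_two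

theorem curv_stdTriple_zero (hB : B ≠ 0) (hp : IsWeakPole p) :
    curv (stdTriple A B p 0) = 2 / ‖B‖ * (1 - p.im) := by
  have hs : 0 < ‖B‖ / 2 := by have := norm_pos_iff.2 hB; positivity
  have h := curv_gdisk A (sub_nonneg.2 hp.im_le_one) hs (stdTriple_disc_zero (B := B))
  refine h.trans ?_
  field_simp

theorem curv_stdTriple_one (hB : B ≠ 0) (hp : IsWeakPole p) :
    curv (stdTriple A B p 1) = 2 / ‖B‖ * (Complex.normSq p - p.im) := by
  have hs : 0 < ‖B‖ / 2 := by have := norm_pos_iff.2 hB; positivity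
  have h := curv_gdisk A (sub_nonneg.2 hp.im_le) hs (stdTriple_disc_one (B := B))
  refine h.trans ?_
  field_simp

theorem curv_stdTriple_two (hB : B ≠ 0) (hp : IsWeakPole p) :
    curv (stdTriple A B p 2) = 2 / ‖B‖ * p.im := by
  have hs : 0 < ‖B‖ / 2 := by have := norm_pos_iff.2 hB; positivity
  have h := curv_gdisk A hp.im_nonneg hs (stdTriple_disc_two (p := p) (B := B))
  refine h.trans ?_
  field_simp

end

section

variable {A B p : ℂ}

theorem IsWeakPole.zero_ne (hp : IsWeakPole p) : (0 : ℂ) ≠ p := by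
  rintro rfl; exact hp.re_ne rfl

theorem IsWeakPole.I_ne (hp : IsWeakPole p) : Complex.I ≠ p := by
  rintro rfl; exact hp.re_ne rfl

theorem closedStdTriple_inter_zero_one (hB : B ≠ 0) (hp : IsWeakPole p) :
    closedStdTriple A B p 0 ∩ closedStdTriple A B p 1 = {mob A B p Complex.I} := by
  ext v
  simp only [Set.mem_inter_iff, Set.mem_singleton_iff]
  constructor
  · rintro ⟨h0, h1⟩
    have hv : v ≠ A := by rintro rfl; exact self_notMem_closedStdTriple_one hB h1
    have hz := mobInv_ne A p hB hv
    rw [← mob_mobInv A p hB hv] at h0 h1 ⊢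
    rw [mob_mem_closedStdTriple_zero hB hz] at h0
    rw [mob_mem_closedStdTriple_one hB hz, Complex.normSq_apply] at h1
    congr 1
    generalize mobInv A B p v = z at *
    have h2 : z.re * z.re = 0 := by nlinarith
    have h3 : z.im = 1 := by nlinarith
    exact Complex.ext (by simpa using h2) (by simpa using h3)
  · rintro rfl
    rw [mob_mem_closedStdTriple_zero hB hp.I_ne, mob_mem_closedStdTriple_one hB hp.I_ne]
    simp

theorem closedStdTriple_inter_one_two (hB : B ≠ 0) (hp : IsWeakPole p) :
    closedStdTriple A B p 1 ∩ closedStdTriple A B p 2 = {mob A B p 0} := by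
  ext v
  simp only [Set.mem_inter_iff, Set.mem_singleton_iff]
  constructor
  · rintro ⟨h1, h2⟩
    have hv : v ≠ A := by rintro rfl; exact self_notMem_closedStdTriple_one hB h1
    have hz := mobInv_ne A p hB hv
    rw [← mob_mobInv A p hB hv] at h1 h2 ⊢
    rw [mob_mem_closedStdTriple_two hB hz] at h2
    rw [mob_mem_closedStdTriple_one hB hz, Complex.normSq_apply] at h1
    congr 1
    generalize mobInv A B p v = z at *
    have h3 : z.re * z.re = 0 := by nlinarith
    have h4 : z.im = 0 := by nlinarith
    exact Complex.ext (by simpa using h3) (by simpa using h4)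
  · rintro rfl
    rw [mob_mem_closedStdTriple_one hB hp.zero_ne, mob_mem_closedStdTriple_two hB hp.zero_ne]
    simp

theorem closedStdTriple_inter_two_zero (hB : B ≠ 0) :
    closedStdTriple A B p 2 ∩ closedStdTriple A B p 0 = {A} := by
  ext v
  simp only [Set.mem_inter_iff, Set.mem_singleton_iff]
  constructor
  · rintro ⟨h2, h0⟩
    by_contra hv
    have hz := mobInv_ne A p hB hv
    rw [← mob_mobInv A p hB hv] at h0 h2
    rw [mob_mem_closedStdTriple_zero hB hz] at h0
    rw [mob_mem_closedStdTriple_two hB hz] at h2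
    linarith
  · rintro rfl
    exact ⟨self_mem_closedStdTriple_two, self_mem_closedStdTriple_zero⟩

theorem isOpenDisk_stdTriple_zero (hB : B ≠ 0) (h : p.im < 1) :
    IsOpenDisk (stdTriple A B p 0) :=
  isOpenDisk_gdisk A (sub_pos.2 h) (half_pos (norm_pos_iff.2 hB)) stdTriple_disc_zero

theorem isOpenDisk_stdTriple_one (hB : B ≠ 0) (h : p.im < Complex.normSq p) :
    IsOpenDisk (stdTriple A B p 1) :=
  isOpenDisk_gdisk A (sub_pos.2 h) (half_pos (norm_pos_iff.2 hB)) stdTriple_disc_one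

theorem isOpenDisk_stdTriple_two (hB : B ≠ 0) (h : 0 < p.im) :
    IsOpenDisk (stdTriple A B p 2) :=
  isOpenDisk_gdisk A h (half_pos (norm_pos_iff.2 hB)) stdTriple_disc_two

theorem isOpenHalfPlane_stdTriple_zero (hB : B ≠ 0) (h : p.im = 1) :
    IsOpenHalfPlane (stdTriple A B p 0) := by
  rw [show stdTriple A B p 0 = gdisk A (1 - p.im) (Complex.I * B / 2) 0 from rfl, h, sub_self]
  exact isOpenHalfPlane_gdisk_zero A (by simpa using hB) _

theorem isOpenHalfPlane_stdTriple_two (hB : B ≠ 0) (h : p.im = 0) :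
    IsOpenHalfPlane (stdTriple A B p 2) := by
  rw [show stdTriple A B p 2 = gdisk A p.im (-(Complex.I * B / 2)) 0 from rfl, h]
  exact isOpenHalfPlane_gdisk_zero A (by simpa using hB) _

theorem isOpenHalfPlane_stdTriple_one (hB : B ≠ 0) (hp : p.re ≠ 0)
    (h : p.im = Complex.normSq p) : IsOpenHalfPlane (stdTriple A B p 1) := by
  rw [show stdTriple A B p 1 = gdisk A (Complex.normSq p - p.im)
    (((starRingEnd ℂ) p + Complex.I / 2) * B) (Complex.normSq B) from rfl, ← h, sub_self]
  refine isOpenHalfPlane_gdisk_zero A (mul_ne_zero ?_ hB) _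
  intro h0
  apply hp
  simpa using congrArg Complex.re h0

theorem isTDT_stdTriple (hB : B ≠ 0) (hp : IsWeakPole p) : IsTDT (stdTriple A B p) := by
  have hre := hp.re_ne
  have h0 := hp.im_nonneg
  have h1 := hp.im_le_one
  have h2 := hp.im_le
  have hsq : 0 < p.re * p.re := mul_self_pos.2 hre
  refine ⟨?_, ?_⟩
  · rcases h0.eq_or_lt with h0 | h0
    · refine Or.inr ⟨2, isOpenHalfPlane_stdTriple_two hB h0.symm, fun k hk => ?_⟩
      have := Complex.normSq_apply p
      fin_cases k
      · exact isOpenDisk_stdTriple_zero hB (by linarith)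
      · exact isOpenDisk_stdTriple_one hB (by nlinarith)
      · exact absurd rfl hk
    rcases h1.eq_or_lt with h1 | h1
    · refine Or.inr ⟨0, isOpenHalfPlane_stdTriple_zero hB h1, fun k hk => ?_⟩
      have := Complex.normSq_apply p
      fin_cases k
      · exact absurd rfl hk
      · exact isOpenDisk_stdTriple_one hB (by rw [h1] at *; linarith)
      · exact isOpenDisk_stdTriple_two hB h0
    rcases h2.eq_or_lt with h2 | h2
    · refine Or.inr ⟨1, isOpenHalfPlane_stdTriple_one hB hre h2, fun k hk => ?_⟩
      fin_cases k
      · exact isOpenDisk_stdTriple_zero hB h1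
      · exact absurd rfl hk
      · exact isOpenDisk_stdTriple_two hB h0
    · refine Or.inl fun k => ?_
      fin_cases k
      · exact isOpenDisk_stdTriple_zero hB h1
      · exact isOpenDisk_stdTriple_one hB h2
      · exact isOpenDisk_stdTriple_two hB h0
  · intro j k hjk
    rw [closure_stdTriple hB hp, closure_stdTriple hB hp]
    fin_cases j <;> fin_cases k
    · exact absurd rfl hjk
    · exact ⟨_, closedStdTriple_inter_zero_one hB hp⟩
    · exact ⟨_, (Set.inter_comm _ _).trans (closedStdTriple_inter_two_zero hB)⟩
    · exact ⟨_, (Set.inter_comm _ _).trans (closedStdTriple_inter_zero_one hB hp)⟩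
    · exact absurd rfl hjk
    · exact ⟨_, closedStdTriple_inter_one_two hB hp⟩
    · exact ⟨_, closedStdTriple_inter_two_zero hB⟩
    · exact ⟨_, (Set.inter_comm _ _).trans (closedStdTriple_inter_one_two hB hp)⟩
    · exact absurd rfl hjk

theorem tangencyPoint_eq {𝒟 : Fin 3 → Set ℂ} {j : Fin 3} {q : ℂ}
    (h : closure (𝒟 (j + 1)) ∩ closure (𝒟 (j + 2)) = {q}) : tangencyPoint 𝒟 j = q := by
  have h2 : closure (𝒟 (j + 1)) ∩ closure (𝒟 (j + 2)) = {tangencyPoint 𝒟 j} :=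
    Classical.epsilon_spec
      (p := fun r : ℂ => closure (𝒟 (j + 1)) ∩ closure (𝒟 (j + 2)) = {r}) ⟨q, h⟩
  exact Set.singleton_injective (h2.symm.trans h)

theorem isTDTplus_stdTriple_iff (hB : B ≠ 0) (hp : IsWeakPole p) :
    IsTDTplus (stdTriple A B p) ↔ p.re < 0 := by
  have t0 : tangencyPoint (stdTriple A B p) 0 = mob A B p 0 := tangencyPoint_eq (by
    change closure (stdTriple A B p 1) ∩ closure (stdTriple A B p 2) = _
    rw [closure_stdTriple hB hp, closure_stdTriple hB hp, closedStdTriple_inter_one_two hB hp])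
  have t1 : tangencyPoint (stdTriple A B p) 1 = A := tangencyPoint_eq (by
    change closure (stdTriple A B p 2) ∩ closure (stdTriple A B p 0) = _
    rw [closure_stdTriple hB hp, closure_stdTriple hB hp, closedStdTriple_inter_two_zero hB])
  have t2 : tangencyPoint (stdTriple A B p) 2 = mob A B p Complex.I := tangencyPoint_eq (by
    change closure (stdTriple A B p 0) ∩ closure (stdTriple A B p 1) = _
    rw [closure_stdTriple hB hp, closure_stdTriple hB hp, closedStdTriple_inter_zero_one hB hp])
  rw [IsTDTplus, t0, t1, t2, and_iff_right (isTDT_stdTriple hB hp)]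
  have hp0 : p ≠ 0 := hp.zero_ne.symm
  have hpI : Complex.I - p ≠ 0 := sub_ne_zero.2 hp.I_ne
  have e1 : A - mob A B p 0 = B / p := by unfold mob; field_simp; ring
  have e2 : mob A B p Complex.I - mob A B p 0 =
      (B / p) * ((Complex.normSq (Complex.I - p))⁻¹ : ℝ) *
        (Complex.I * (starRingEnd ℂ) (Complex.I - p)) := by
    rw [mob_sub_mob A p hp.I_ne hp.zero_ne, Complex.ofReal_inv, ← Complex.mul_conj]
    have : (starRingEnd ℂ) (Complex.I - p) ≠ 0 := (map_ne_zero _).2 hpI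
    rw [zero_sub, zero_sub]
    field_simp
  rw [e1, e2]
  have hk : 0 < Complex.normSq (B / p) := Complex.normSq_pos.2 (div_ne_zero hB hp0)
  have hl : 0 < (Complex.normSq (Complex.I - p))⁻¹ := inv_pos.2 (Complex.normSq_pos.2 hpI)
  generalize B / p = u at *
  generalize (Complex.normSq (Complex.I - p))⁻¹ = l at *
  have e3 : u.re * (u * (l : ℂ) * (Complex.I * (starRingEnd ℂ) (Complex.I - p))).im -
      u.im * (u * (l : ℂ) * (Complex.I * (starRingEnd ℂ) (Complex.I - p))).re =
      (Complex.normSq u * l) * (-p.re) := by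
    simp [Complex.normSq_apply]; ring
  rw [e3, mul_pos_iff_of_pos_left (mul_pos hk hl), neg_pos]

end

/-- The right component of the complement of the half-planes `{1 ≤ im z}`, `{im z ≤ 0}` and the
closed disk with center `i / 2` and radius `1 / 2`. -/
def rightRegion : Set ℂ := {z | 0 < z.re ∧ 0 < z.im ∧ z.im < 1 ∧ z.im < Complex.normSq z}

/-- The left component of the complement of the half-planes `{1 ≤ im z}`, `{im z ≤ 0}` and the
closed disk with center `i / 2` and radius `1 / 2`. -/
def leftRegion : Set ℂ := {z | z.re < 0 ∧ 0 < z.im ∧ z.im < 1 ∧ z.im < Complex.normSq z}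

theorem mem_rightRegion {z : ℂ} :
    z ∈ rightRegion ↔ 0 < z.re ∧ 0 < z.im ∧ z.im < 1 ∧ z.im < Complex.normSq z := Iff.rfl

theorem mem_leftRegion {z : ℂ} :
    z ∈ leftRegion ↔ z.re < 0 ∧ 0 < z.im ∧ z.im < 1 ∧ z.im < Complex.normSq z := Iff.rfl

theorem isOpen_rightRegion : IsOpen rightRegion :=
  (isOpen_lt continuous_const Complex.continuous_re).inter <|
    (isOpen_lt continuous_const Complex.continuous_im).inter <|
    (isOpen_lt Complex.continuous_im continuous_const).inter <|
    isOpen_lt Complex.continuous_im Complex.continuous_normSq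

theorem isOpen_leftRegion : IsOpen leftRegion :=
  (isOpen_lt Complex.continuous_re continuous_const).inter <|
    (isOpen_lt continuous_const Complex.continuous_im).inter <|
    (isOpen_lt Complex.continuous_im continuous_const).inter <|
    isOpen_lt Complex.continuous_im Complex.continuous_normSq

theorem disjoint_rightRegion_leftRegion : Disjoint rightRegion leftRegion := by
  rw [Set.disjoint_left]
  intro z h1 h2
  exact lt_asymm h1.1 h2.1

theorem segment_estimate {x y L s : ℝ} (hx : 0 < x) (hy0 : 0 ≤ y) (hy1 : y ≤ 1)
    (hxy : y ≤ x * x + y * y) (hL : 1 ≤ L) (hLx : 1 / 4 ≤ L * x) (hs0 : 0 ≤ s) (hs1 : s < 1) :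
    0 < (1 - s) * L + s * x ∧ 0 < (1 - s) * (1 / 2) + s * y ∧ (1 - s) * (1 / 2) + s * y < 1 ∧
      (1 - s) * (1 / 2) + s * y < ((1 - s) * L + s * x) * ((1 - s) * L + s * x) +
        ((1 - s) * (1 / 2) + s * y) * ((1 - s) * (1 / 2) + s * y) := by
  have h1 : 0 < 1 - s := by linarith
  have hsy := mul_nonneg hs0 hy0
  have hsy1 := mul_le_mul_of_nonneg_left hy1 hs0
  refine ⟨by nlinarith [mul_nonneg hs0 hx.le], by linarith, by linarith, ?_⟩
  have e1 : 0 ≤ s * s * (x * x + y * y - y) := mul_nonneg (mul_nonneg hs0 hs0) (by linarith)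
  have e2 : 0 ≤ s * (1 - s) * (L * x - 1 / 4) :=
    mul_nonneg (mul_nonneg hs0 h1.le) (by linarith)
  have e3 : 0 < (1 - s) * (1 - s) * (L * L - 1 / 4) := mul_pos (mul_pos h1 h1) (by nlinarith)
  nlinarith

/-- The segment from `c` to `q`. -/
noncomputable def segPath (c q : ℂ) (s : ℝ) : ℂ := ((1 - s : ℝ) : ℂ) * c + (s : ℂ) * q

theorem segPath_re (c q : ℂ) (s : ℝ) : (segPath c q s).re = (1 - s) * c.re + s * q.re := by
  simp [segPath, Complex.mul_re]

theorem segPath_im (c q : ℂ) (s : ℝ) : (segPath c q s).im = (1 - s) * c.im + s * q.im := by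
  simp [segPath, Complex.mul_im]

theorem continuous_segPath (c q : ℂ) : Continuous (segPath c q) := by
  unfold segPath; fun_prop

theorem segPath_zero (c q : ℂ) : segPath c q 0 = c := by simp [segPath]

theorem segPath_one (c q : ℂ) : segPath c q 1 = q := by simp [segPath]

theorem segPath_injective {c q : ℂ} (h : c ≠ q) : Function.Injective (segPath c q) := by
  intro s t hst
  have h1 : ((s : ℂ) - t) * (q - c) = 0 := by
    simp only [segPath, Complex.ofReal_sub, Complex.ofReal_one] at hst
    linear_combination hst
  rcases mul_eq_zero.1 h1 with h2 | h2
  · exact_mod_cast sub_eq_zero.1 h2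
  · exact absurd (sub_eq_zero.1 h2).symm h

theorem segPath_mem_leftRegion {q : ℂ} {L s : ℝ} (hx : q.re < 0) (hy0 : 0 ≤ q.im)
    (hy1 : q.im ≤ 1) (hxy : q.im ≤ Complex.normSq q) (hL : 1 ≤ L) (hLx : 1 / 4 ≤ L * -q.re)
    (hs0 : 0 ≤ s) (hs1 : s < 1) : segPath ⟨-L, 1 / 2⟩ q s ∈ leftRegion := by
  rw [Complex.normSq_apply] at hxy
  obtain ⟨h1, h2, h3, h4⟩ := segment_estimate (x := -q.re) (y := q.im) (by linarith) hy0 hy1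
    (by linarith) hL hLx hs0 hs1
  rw [mem_leftRegion, Complex.normSq_apply, segPath_re, segPath_im]
  exact ⟨by dsimp only; linarith, h2, h3, by dsimp only; linarith⟩

theorem segPath_mem_rightRegion {q : ℂ} {L s : ℝ} (hq : q ∈ rightRegion) (hL : 1 ≤ L)
    (hLx : 1 / 4 ≤ L * q.re) (hs0 : 0 ≤ s) (hs1 : s ≤ 1) :
    segPath ⟨L, 1 / 2⟩ q s ∈ rightRegion := by
  rcases hs1.eq_or_lt with rfl | hs1
  · rwa [segPath_one]
  obtain ⟨hx, hy0, hy1, hxy⟩ := hq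
  rw [Complex.normSq_apply] at hxy
  obtain ⟨h1, h2, h3, h4⟩ := segment_estimate (x := q.re) (y := q.im) hx hy0.le hy1.le
    hxy.le hL hLx hs0 hs1
  rw [mem_rightRegion, Complex.normSq_apply, segPath_re, segPath_im]
  exact ⟨h1, h2, h3, h4⟩

theorem isPreconnected_segPath_image (c q : ℂ) {I : Set ℝ} (hI : IsPreconnected I) :
    IsPreconnected (segPath c q '' I) := hI.image _ (continuous_segPath c q).continuousOn

theorem quarter_le_mul {x L : ℝ} (hx : 0 < x) (hL : 1 / x ≤ L) : 1 / 4 ≤ L * x := by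
  rw [div_le_iff₀ hx] at hL
  linarith

theorem isPreconnected_rightRegion : IsPreconnected rightRegion := by
  apply isPreconnected_of_forall_pair
  intro z hz w hw
  set L : ℝ := 1 + 1 / z.re + 1 / w.re
  have h1 : 0 < 1 / z.re := one_div_pos.2 hz.1
  have h2 : 0 < 1 / w.re := one_div_pos.2 hw.1
  have hL : 1 ≤ L := by linarith
  refine ⟨segPath ⟨L, 1 / 2⟩ z '' Set.Icc 0 1 ∪ segPath ⟨L, 1 / 2⟩ w '' Set.Icc 0 1, ?_,
    Or.inl ⟨1, by simp, segPath_one _ _⟩, Or.inr ⟨1, by simp, segPath_one _ _⟩, ?_⟩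
  · rintro _ (⟨s, hs, rfl⟩ | ⟨s, hs, rfl⟩)
    · exact segPath_mem_rightRegion hz hL (quarter_le_mul hz.1 (by linarith)) hs.1 hs.2
    · exact segPath_mem_rightRegion hw hL (quarter_le_mul hw.1 (by linarith)) hs.1 hs.2
  · exact (isPreconnected_segPath_image _ _ isPreconnected_Icc).union ⟨L, 1 / 2⟩
      ⟨0, by simp, segPath_zero _ _⟩ ⟨0, by simp, segPath_zero _ _⟩
      (isPreconnected_segPath_image _ _ isPreconnected_Icc)

theorem exists_isPreconnected_leftRegion {p z : ℂ} (hp : IsPole p) (hz : z ∈ leftRegion)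
    (hzp : z ≠ p) : ∃ S ⊆ leftRegion \ {p}, IsPreconnected S ∧ z ∈ S ∧ p ∈ closure S := by
  have hzr := hz.1
  have hpr := hp.re_neg
  obtain ⟨L, hL, hLz, hLp, hLz', hLp'⟩ : ∃ L : ℝ, 1 ≤ L ∧ 1 / -z.re ≤ L ∧ 1 / -p.re ≤ L ∧
      -z.re < L ∧ -p.re < L := by
    have h1 : 0 < 1 / -z.re := one_div_pos.2 (by linarith)
    have h2 : 0 < 1 / -p.re := one_div_pos.2 (by linarith)
    generalize 1 / -z.re = a at *
    generalize 1 / -p.re = b at *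
    exact ⟨1 + a + b - z.re - p.re, by linarith, by linarith, by linarith, by linarith,
      by linarith⟩
  set c : ℂ := ⟨-L, 1 / 2⟩
  have hcz : c ≠ z := by
    intro h
    have : -L = z.re := congrArg Complex.re h
    linarith
  have hcp : c ≠ p := by
    intro h
    have : -L = p.re := congrArg Complex.re h
    linarith
  have memz : ∀ s ∈ Set.Icc (0 : ℝ) 1, segPath c z s ∈ leftRegion := by
    intro s hs
    rcases hs.2.eq_or_lt with rfl | hs1
    · rwa [segPath_one]
    · exact segPath_mem_leftRegion hz.1 hz.2.1.le hz.2.2.1.le hz.2.2.2.le hL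
        (quarter_le_mul (by linarith) hLz) hs.1 hs1
  by_cases hps : p ∈ segPath c z '' Set.Icc 0 1
  · obtain ⟨s, hs, rfl⟩ := hps
    have hs1 : s < 1 := lt_of_le_of_ne hs.2 (by rintro rfl; exact hzp (segPath_one _ _).symm)
    refine ⟨segPath c z '' Set.Ioc s 1, ?_, isPreconnected_segPath_image _ _ isPreconnected_Ioc,
      ⟨1, ⟨hs1, le_rfl⟩, segPath_one _ _⟩, ?_⟩
    · rintro _ ⟨t, ht, rfl⟩
      exact ⟨memz t ⟨hs.1.trans ht.1.le, ht.2⟩,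
        fun h => ht.1.ne' (segPath_injective hcz h)⟩
    · apply image_closure_subset_closure_image (continuous_segPath c z)
      rw [closure_Ioc hs1.ne]
      exact ⟨s, ⟨le_rfl, hs1.le⟩, rfl⟩
  · refine ⟨segPath c z '' Set.Icc 0 1 ∪ segPath c p '' Set.Ico 0 1, ?_, ?_,
      Or.inl ⟨1, by simp, segPath_one _ _⟩, ?_⟩
    · rintro _ (⟨t, ht, rfl⟩ | ⟨t, ht, rfl⟩)
      · exact ⟨memz t ht, fun h => hps ⟨t, ht, h⟩⟩
      · refine ⟨segPath_mem_leftRegion hpr hp.im_nonneg hp.im_le_one hp.im_le hL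
          (quarter_le_mul (by linarith) hLp) ht.1 ht.2, fun h => ?_⟩
        exact ht.2.ne (segPath_injective hcp (h.trans (segPath_one c p).symm))
    · exact (isPreconnected_segPath_image _ _ isPreconnected_Icc).union c
        ⟨0, by simp, segPath_zero _ _⟩ ⟨0, by simp, segPath_zero _ _⟩
        (isPreconnected_segPath_image _ _ isPreconnected_Ico)
    · refine closure_mono Set.subset_union_right ?_
      apply image_closure_subset_closure_image (continuous_segPath c p)
      rw [closure_Ico one_ne_zero.symm]
      exact ⟨1, by simp, segPath_one _ _⟩

section

variable {A B p : ℂ}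

theorem ne_of_re_nonneg (hp : IsPole p) {z : ℂ} (hz : 0 ≤ z.re) : z ≠ p := by
  rintro rfl
  exact absurd hp.re_neg (not_lt.2 hz)

theorem ne_of_mem_compl_iUnion (hB : B ≠ 0) (hp : IsPole p) {v : ℂ}
    (hv : v ∈ (⋃ j, closure (stdTriple A B p j))ᶜ) : v ≠ A := by
  rintro rfl
  apply hv
  refine Set.mem_iUnion.2 ⟨0, ?_⟩
  rw [closure_stdTriple hB hp.toIsWeakPole]
  exact self_mem_closedStdTriple_zero

theorem mob_mem_compl_iUnion_iff (hB : B ≠ 0) (hp : IsPole p) {z : ℂ} (hz : z ≠ p) :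
    mob A B p z ∈ (⋃ j, closure (stdTriple A B p j))ᶜ ↔ z ∈ rightRegion ∪ leftRegion := by
  simp only [closure_stdTriple hB hp.toIsWeakPole, Set.mem_compl_iff, Set.mem_iUnion,
    not_exists, Fin.forall_fin_succ, IsEmpty.forall_iff, and_true]
  change mob A B p z ∉ closedStdTriple A B p 0 ∧ mob A B p z ∉ closedStdTriple A B p 1 ∧
    mob A B p z ∉ closedStdTriple A B p 2 ↔ _
  rw [mob_mem_closedStdTriple_zero hB hz, mob_mem_closedStdTriple_one hB hz,
    mob_mem_closedStdTriple_two hB hz, not_le, not_le, not_le, Set.mem_union, mem_rightRegion,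
    mem_leftRegion]
  constructor
  · rintro ⟨h1, h2, h3⟩
    rcases lt_trichotomy z.re 0 with h | h | h
    · exact Or.inr ⟨h, h3, h1, h2⟩
    · rw [Complex.normSq_apply, h] at h2
      nlinarith
    · exact Or.inl ⟨h, h3, h1, h2⟩
  · rintro (⟨-, h3, h1, h2⟩ | ⟨-, h3, h1, h2⟩) <;> exact ⟨h1, h2, h3⟩

theorem isBounded_mob_image (B A : ℂ) (hp : IsPole p) :
    Bornology.IsBounded (mob A B p '' {z | 0 ≤ z.re}) := by
  rw [isBounded_iff_forall_norm_le]
  refine ⟨‖A‖ + ‖B‖ / -p.re, ?_⟩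
  rintro _ ⟨z, hz, rfl⟩
  have hz' : 0 ≤ z.re := hz
  have hpr := hp.re_neg
  refine (norm_add_le _ _).trans ?_
  rw [norm_div]
  gcongr
  · linarith
  · calc -p.re ≤ (z - p).re := by rw [Complex.sub_re]; linarith
      _ ≤ ‖z - p‖ := Complex.re_le_norm _

theorem mob_image_eq_connectedComponentIn (hB : B ≠ 0) (hp : IsPole p) {v : ℂ}
    (hv : v ∈ mob A B p '' rightRegion) :
    mob A B p '' rightRegion =
      connectedComponentIn (⋃ j, closure (stdTriple A B p j))ᶜ v := by
  have hsub : mob A B p '' rightRegion ⊆ (⋃ j, closure (stdTriple A B p j))ᶜ := by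
    rintro _ ⟨z, hz, rfl⟩
    exact (mob_mem_compl_iUnion_iff hB hp (ne_of_re_nonneg hp hz.1.le)).2 (Or.inl hz)
  apply Set.Subset.antisymm
  · refine IsPreconnected.subset_connectedComponentIn ?_ hv hsub
    refine isPreconnected_rightRegion.image _ fun z hz => ?_
    exact (mob_continuousAt A p (ne_of_re_nonneg hp hz.1.le)).continuousWithinAt
  · set C := connectedComponentIn (⋃ j, closure (stdTriple A B p j))ᶜ v
    have hCU : C ⊆ (⋃ j, closure (stdTriple A B p j))ᶜ := connectedComponentIn_subset _ _
    have hC : IsPreconnected (mobInv A B p '' C) :=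
      isPreconnected_connectedComponentIn.image _ fun u hu =>
        (mobInv_continuousAt A p (ne_of_mem_compl_iUnion hB hp (hCU hu))).continuousWithinAt
    have hsub2 : mobInv A B p '' C ⊆ rightRegion := by
      refine IsPreconnected.subset_left_of_subset_union isOpen_rightRegion isOpen_leftRegion
        disjoint_rightRegion_leftRegion ?_ ?_ hC
      · rintro _ ⟨u, hu, rfl⟩
        have hu' := hCU hu
        have huA := ne_of_mem_compl_iUnion hB hp hu'
        rw [← mob_mobInv A p hB huA] at hu'
        exact (mob_mem_compl_iUnion_iff hB hp (mobInv_ne A p hB huA)).1 hu'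
      · obtain ⟨z, hz, rfl⟩ := hv
        refine ⟨z, ⟨mob A B p z, mem_connectedComponentIn (hsub ⟨z, hz, rfl⟩),
          mobInv_mob A p hB (ne_of_re_nonneg hp hz.1.le)⟩, hz⟩
    intro u hu
    exact ⟨mobInv A B p u, hsub2 ⟨u, hu, rfl⟩,
      mob_mobInv A p hB (ne_of_mem_compl_iUnion hB hp (hCU hu))⟩

theorem not_isBounded_mob_image (hB : B ≠ 0) {S : Set ℂ} (hS : p ∉ S) (hpS : p ∈ closure S) :
    ¬ Bornology.IsBounded (mob A B p '' S) := by
  intro h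
  rw [isBounded_iff_forall_norm_le] at h
  obtain ⟨R, hR⟩ := h
  have hBn : 0 < ‖B‖ := norm_pos_iff.2 hB
  obtain ⟨z, hz, hd⟩ := Metric.mem_closure_iff.1 hpS (‖B‖ / (|R| + ‖A‖ + 1)) (by positivity)
  have hzp : z ≠ p := by rintro rfl; exact hS hz
  have h1 := hR _ ⟨z, hz, rfl⟩
  have h2 : ‖B / (z - p)‖ ≤ |R| + ‖A‖ := by
    have e : B / (z - p) = mob A B p z - A := by simp [mob]
    rw [e]
    exact (norm_sub_le _ _).trans (by linarith [le_abs_self R])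
  have h3 : 0 < ‖z - p‖ := norm_pos_iff.2 (sub_ne_zero.2 hzp)
  rw [norm_div, div_le_iff₀ h3] at h2
  rw [dist_comm, dist_eq_norm, lt_div_iff₀ (by positivity)] at hd
  nlinarith

theorem idealTriangle_stdTriple (hB : B ≠ 0) (hp : IsPole p) :
    idealTriangle (stdTriple A B p) = mob A B p '' rightRegion := by
  have hne : (⟨2, 1 / 2⟩ : ℂ) ∈ rightRegion := by
    rw [mem_rightRegion, Complex.normSq_apply]; norm_num
  have hv : mob A B p ⟨2, 1 / 2⟩ ∈ mob A B p '' rightRegion := ⟨_, hne, rfl⟩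
  have hb : Bornology.IsBounded (mob A B p '' rightRegion) :=
    (isBounded_mob_image B A hp).subset (Set.image_mono fun z hz => hz.1.le)
  have hspec := Classical.epsilon_spec (p := fun T : Set ℂ => Bornology.IsBounded T ∧
    ∃ z ∈ (⋃ j, closure (stdTriple A B p j))ᶜ,
      T = connectedComponentIn (⋃ j, closure (stdTriple A B p j))ᶜ z)
    ⟨_, hb, _, (mob_mem_compl_iUnion_iff hB hp (ne_of_re_nonneg hp hne.1.le)).2 (Or.inl hne),
      mob_image_eq_connectedComponentIn hB hp hv⟩
  change Bornology.IsBounded (idealTriangle (stdTriple A B p)) ∧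
    ∃ z ∈ (⋃ j, closure (stdTriple A B p j))ᶜ, idealTriangle (stdTriple A B p) =
      connectedComponentIn (⋃ j, closure (stdTriple A B p j))ᶜ z at hspec
  obtain ⟨hbd, w, hw, heq⟩ := hspec
  have hwA := ne_of_mem_compl_iUnion hB hp hw
  have hzp := mobInv_ne A p hB hwA
  have hwz := mob_mobInv A p hB hwA
  generalize mobInv A B p w = z at hzp hwz
  subst hwz
  rcases (mob_mem_compl_iUnion_iff hB hp hzp).1 hw with hz | hz
  · rw [heq, ← mob_image_eq_connectedComponentIn hB hp ⟨z, hz, rfl⟩]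
  · exfalso
    obtain ⟨S, hS, hSc, hzS, hpS⟩ := exists_isPreconnected_leftRegion hp hz hzp
    refine not_isBounded_mob_image (A := A) hB (fun h => (hS h).2 rfl) hpS (hbd.subset ?_)
    rw [heq]
    refine IsPreconnected.subset_connectedComponentIn ?_ ⟨z, hzS, rfl⟩ ?_
    · exact hSc.image _ fun u hu => (mob_continuousAt A p (hS hu).2).continuousWithinAt
    · rintro _ ⟨u, hu, rfl⟩
      exact (mob_mem_compl_iUnion_iff hB hp (hS hu).2).2 (Or.inr (hS hu).1)

end

section

variable {A B p : ℂ}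

theorem mob_add_one (A B p z : ℂ) : mob A B p (z + 1) = mob A B (p - 1) z := by
  unfold mob; congr 2; ring

theorem IsPole.sub_one (hp : IsPole p) : IsPole (p - 1) := by
  have h1 := hp.re_neg
  have h2 := hp.im_le
  rw [Complex.normSq_apply] at h2
  refine ⟨⟨?_, ?_, ?_, ?_⟩, ?_⟩
  · rw [Complex.sub_re, Complex.one_re]; linarith
  · simpa using hp.im_nonneg
  · simpa using hp.im_le_one
  · rw [Complex.normSq_apply]; simp; nlinarith
  · rw [Complex.sub_re, Complex.one_re]; linarith

theorem stdTriple_sub_one_zero : stdTriple A B (p - 1) 0 = stdTriple A B p 0 := by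
  simp [stdTriple]

theorem stdTriple_sub_one_two : stdTriple A B (p - 1) 2 = stdTriple A B p 2 := by
  simp [stdTriple]

theorem isInscribedDisk_stdTriple (hB : B ≠ 0) (hp : IsPole p) :
    IsInscribedDisk (stdTriple A B p) (stdTriple A B (p - 1) 1) := by
  have hp' := hp.sub_one
  have hpr := hp.re_neg
  refine ⟨isOpenDisk_stdTriple_one hB ?_, ?_, ?_⟩
  · have h2 := hp.im_le
    rw [Complex.normSq_apply] at h2 ⊢
    simp
    nlinarith
  · rw [idealTriangle_stdTriple hB hp]
    intro v hv
    have hvA : v ≠ A := by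
      rintro rfl
      have := subset_closure hv
      rw [closure_stdTriple hB hp'.toIsWeakPole] at this
      exact self_notMem_closedStdTriple_one hB this
    have hz := mobInv_ne A (p - 1) hB hvA
    rw [← mob_mobInv A (p - 1) hB hvA] at hv ⊢
    rw [mob_mem_stdTriple_one hB hz] at hv
    refine ⟨mobInv A B (p - 1) v + 1, ?_, mob_add_one _ _ _ _⟩
    generalize mobInv A B (p - 1) v = z at hv
    rw [mem_rightRegion]
    rw [Complex.normSq_apply] at hv ⊢
    simp only [Complex.add_re, Complex.add_im, Complex.one_re, Complex.one_im, add_zero]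
    refine ⟨?_, ?_, ?_, ?_⟩ <;> nlinarith [sq_nonneg (z.im - 1 / 2), sq_nonneg (z.re - 1 / 2),
      sq_nonneg (z.re + 1 / 2)]
  · intro j
    rw [closure_stdTriple hB hp'.toIsWeakPole]
    fin_cases j
    · change ∃ q, _ ∩ closure (stdTriple A B p 0) = {q}
      rw [← stdTriple_sub_one_zero, closure_stdTriple hB hp'.toIsWeakPole, Set.inter_comm]
      exact ⟨_, closedStdTriple_inter_zero_one hB hp'.toIsWeakPole⟩
    · change ∃ q, _ ∩ closure (stdTriple A B p 1) = {q}
      rw [closure_stdTriple hB hp.toIsWeakPole]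
      refine ⟨mob A B p ⟨1 / 2, 1 / 2⟩, ?_⟩
      have h0 : (⟨1 / 2, 1 / 2⟩ : ℂ) ≠ p := ne_of_re_nonneg hp (by norm_num)
      have h1 : (⟨-(1 / 2), 1 / 2⟩ : ℂ) ≠ p - 1 := by
        intro h
        have := congrArg Complex.re h
        simp at this
        linarith
      have h2 : mob A B p ⟨1 / 2, 1 / 2⟩ = mob A B (p - 1) ⟨-(1 / 2), 1 / 2⟩ := by
        rw [← mob_add_one]
        congr 1
        apply Complex.ext <;> norm_num
      ext v
      simp only [Set.mem_inter_iff, Set.mem_singleton_iff]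
      constructor
      · rintro ⟨ha, hb⟩
        have hvA : v ≠ A := by rintro rfl; exact self_notMem_closedStdTriple_one hB hb
        have hz := mobInv_ne A (p - 1) hB hvA
        have hz' : mobInv A B (p - 1) v + 1 ≠ p := fun h => hz (eq_sub_of_add_eq h)
        rw [← mob_mobInv A (p - 1) hB hvA] at ha hb ⊢
        rw [← mob_add_one, mob_mem_closedStdTriple_one hB hz'] at hb
        rw [mob_mem_closedStdTriple_one hB hz] at ha
        rw [h2]
        congr 1
        generalize mobInv A B (p - 1) v = z at *
        rw [Complex.normSq_apply] at ha hb
        simp only [Complex.add_re, Complex.add_im, Complex.one_re, Complex.one_im, add_zero] at hb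
        have e1 : (z.re + 1 / 2) ^ 2 + (z.im - 1 / 2) ^ 2 ≤ 0 := by nlinarith
        have e2 : (z.re + 1 / 2) ^ 2 = 0 := by
          nlinarith [sq_nonneg (z.re + 1 / 2), sq_nonneg (z.im - 1 / 2)]
        have e3 : (z.im - 1 / 2) ^ 2 = 0 := by
          nlinarith [sq_nonneg (z.re + 1 / 2), sq_nonneg (z.im - 1 / 2)]
        rw [sq_eq_zero_iff] at e2 e3
        apply Complex.ext <;> dsimp only <;> linarith
      · rintro rfl
        refine ⟨?_, ?_⟩
        · rw [h2, mob_mem_closedStdTriple_one hB h1, Complex.normSq_apply]; norm_num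
        · rw [mob_mem_closedStdTriple_one hB h0, Complex.normSq_apply]; norm_num
    · change ∃ q, _ ∩ closure (stdTriple A B p 2) = {q}
      rw [← stdTriple_sub_one_two, closure_stdTriple hB hp'.toIsWeakPole]
      exact ⟨_, closedStdTriple_inter_one_two hB hp'.toIsWeakPole⟩

theorem form_ball_mob (c : ℝ) (b : ℂ) (A : ℂ) {z : ℂ} (hz : z ≠ p) :
    Complex.normSq (mob A B p z - A) + 2 * (b * (starRingEnd ℂ) (mob A B p z - A)).re + c =
      (Complex.normSq (z - p))⁻¹ * (c * Complex.normSq (z - p) +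
        2 * ((starRingEnd ℂ) b * B * (starRingEnd ℂ) (z - p)).re + Complex.normSq B) := by
  have h0 := normSq_pos_of_ne hz
  rw [mob, add_sub_cancel_left, Complex.normSq_div]
  have h1 : (b * (starRingEnd ℂ) (B / (z - p))).re =
      (Complex.normSq (z - p))⁻¹ * ((starRingEnd ℂ) b * B * (starRingEnd ℂ) (z - p)).re := by
    rw [← Complex.conj_re, ← Complex.re_ofReal_mul]
    congr 1
    rw [map_mul, Complex.conj_conj, Complex.ofReal_inv, ← Complex.mul_conj]
    have h2 := sub_ne_zero.2 hz
    have h3 : (starRingEnd ℂ) (z - p) ≠ 0 := (map_ne_zero _).2 h2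
    field_simp
  rw [h1]
  field_simp
  ring

theorem exists_notMem_rightRegion {γ : ℝ} {β : ℂ} (hp : IsPole p) (hγ : γ ≤ 0) (hβ : β ≠ 0) :
    ∃ z, z ∈ gdisk p γ β (Complex.normSq B) ∧ z ∉ rightRegion := by
  have hβ' : 0 < Complex.normSq β := Complex.normSq_pos.2 hβ
  obtain ⟨t, ht⟩ : ∃ t : ℝ, Complex.normSq B < 2 * t * Complex.normSq β := by
    refine ⟨Complex.normSq B / Complex.normSq β + 1, ?_⟩
    have h0 : 0 ≤ Complex.normSq B := Complex.normSq_nonneg B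
    have : (Complex.normSq B / Complex.normSq β) * Complex.normSq β = Complex.normSq B :=
      div_mul_cancel₀ _ hβ'.ne'
    nlinarith
  have key : ∀ k : ℝ, p + β * ⟨-t, k⟩ ∈ gdisk p γ β (Complex.normSq B) := by
    intro k
    rw [mem_gdisk, add_sub_cancel_left]
    have e : (β * (starRingEnd ℂ) (β * ⟨-t, k⟩)).re = -t * Complex.normSq β := by
      simp [Complex.normSq_apply, Complex.mul_re, Complex.mul_im]; ring
    rw [e]
    nlinarith [mul_nonneg (neg_nonneg.2 hγ) (Complex.normSq_nonneg (β * ⟨-t, k⟩))]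
  by_cases hr : β.re = 0
  · refine ⟨_, key 0, fun h => ?_⟩
    have := h.1
    simp [Complex.mul_re, hr] at this
    linarith [hp.re_neg]
  · refine ⟨_, key ((1 + t * β.im) / β.re), fun h => ?_⟩
    have h1 := h.2.2.1
    rw [Complex.add_im, Complex.mul_im] at h1
    dsimp only at h1
    rw [mul_div_cancel₀ _ hr] at h1
    linarith [hp.im_nonneg]

theorem ball_eq_of_subset_rightRegion {e : ℂ} {ρ : ℝ} (hρ : 0 < ρ)
    (hsub : Metric.ball e ρ ⊆ rightRegion)
    (h0 : ∃ z ∈ Metric.closedBall e ρ, 1 ≤ z.im)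
    (h1 : ∃ z ∈ Metric.closedBall e ρ, Complex.normSq z ≤ z.im)
    (h2 : ∃ z ∈ Metric.closedBall e ρ, z.im ≤ 0) : e = 1 + Complex.I / 2 ∧ ρ = 1 / 2 := by
  have him : ∀ z ∈ Metric.closedBall e ρ, |z.im - e.im| ≤ ρ := by
    intro z hz
    rw [Metric.mem_closedBall, dist_eq_norm] at hz
    rw [← Complex.sub_im]
    exact (Complex.abs_im_le_norm _).trans hz
  have hcl : Metric.closedBall e ρ ⊆ {z | 0 ≤ z.re ∧ 0 ≤ z.im ∧ z.im ≤ 1} := by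
    rw [← closure_ball e hρ.ne']
    refine closure_minimal (fun z hz => ?_) ?_
    · have := hsub hz
      exact ⟨this.1.le, this.2.1.le, this.2.2.1.le⟩
    · exact (isClosed_le continuous_const Complex.continuous_re).inter <|
        (isClosed_le continuous_const Complex.continuous_im).inter <|
        isClosed_le Complex.continuous_im continuous_const
  have hlow := hcl (a := ⟨e.re, e.im - ρ⟩) (by
    rw [mem_closedBall_iff_normSq hρ, Complex.normSq_apply]; simp; nlinarith)
  have hhigh := hcl (a := ⟨e.re, e.im + ρ⟩) (by
    rw [mem_closedBall_iff_normSq hρ, Complex.normSq_apply]; simp; nlinarith)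
  have hleft := hcl (a := ⟨e.re - ρ, e.im⟩) (by
    rw [mem_closedBall_iff_normSq hρ, Complex.normSq_apply]; simp; nlinarith)
  have l1 : 0 ≤ e.im - ρ := hlow.2.1
  have l2 : e.im + ρ ≤ 1 := hhigh.2.2
  have l3 : 0 ≤ e.re - ρ := hleft.1
  obtain ⟨z0, hz0, hz0'⟩ := h0
  obtain ⟨z2, hz2, hz2'⟩ := h2
  have l4 := (abs_le.1 (him z0 hz0)).2
  have l5 := (abs_le.1 (him z2 hz2)).1
  have hρ2 : ρ = 1 / 2 := by linarith
  have hei : e.im = 1 / 2 := by linarith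
  subst hρ2
  refine ⟨?_, rfl⟩
  obtain ⟨z1, hz1, hz1'⟩ := h1
  rw [mem_closedBall_iff_normSq (by norm_num), Complex.normSq_apply, Complex.sub_re,
    Complex.sub_im, hei] at hz1
  rw [Complex.normSq_apply] at hz1'
  have l6 : e.re ≤ 1 := by
    have m1 : z1.re ≤ 1 / 2 := abs_le_of_sq_le_sq' (by nlinarith [sq_nonneg (z1.im - 1 / 2)])
      (by norm_num) |>.2
    have m2 : -(1 / 2) ≤ z1.re - e.re := abs_le_of_sq_le_sq'
      (by nlinarith [sq_nonneg (z1.im - 1 / 2)]) (by norm_num) |>.1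
    linarith
  have l7 : 1 ≤ e.re := by
    by_contra! hlt
    have := hsub (a := ⟨1 / 2, 1 / 2⟩) (by
      rw [mem_ball_iff_normSq (by norm_num), Complex.normSq_apply, Complex.sub_re,
        Complex.sub_im, hei]
      dsimp only
      nlinarith)
    have := this.2.2.2
    rw [Complex.normSq_apply] at this
    norm_num at this
  apply Complex.ext
  · simp; linarith
  · simp; linarith

theorem eq_of_isInscribedDisk (hB : B ≠ 0) (hp : IsPole p) {D : Set ℂ}
    (hD : IsInscribedDisk (stdTriple A B p) D) : D = stdTriple A B (p - 1) 1 := by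
  obtain ⟨⟨c, r, hr, rfl⟩, hsub, htan⟩ := hD
  rw [idealTriangle_stdTriple hB hp] at hsub
  have hBpos : 0 < Complex.normSq B := Complex.normSq_pos.2 hB
  have hAimg : A ∉ mob A B p '' rightRegion := by
    rintro ⟨z, hz, h⟩
    exact mob_ne A p hB (ne_of_re_nonneg hp hz.1.le) h
  have hAD : A ∉ Metric.ball c r := fun h => hAimg (hsub h)
  set b : ℂ := A - c with hb
  have hb0 : b ≠ 0 := by
    intro h
    apply hAD
    rw [sub_eq_zero.1 h]
    exact Metric.mem_ball_self hr
  set γ : ℝ := Complex.normSq b - r ^ 2 with hγ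
  set β : ℂ := (starRingEnd ℂ) b * B with hβ
  have hβ0 : β ≠ 0 := mul_ne_zero ((map_ne_zero _).2 hb0) hB
  have expand : ∀ v, Complex.normSq (v - c) - r ^ 2 =
      Complex.normSq (v - A) + 2 * (b * (starRingEnd ℂ) (v - A)).re + γ := by
    intro v
    simp [hγ, hb, Complex.normSq_apply, Complex.mul_re]; ring
  have memD : ∀ z, z ≠ p → (mob A B p z ∈ Metric.ball c r ↔
      z ∈ gdisk p γ β (Complex.normSq B)) := by
    intro z hz
    rw [mem_ball_iff_normSq hr, ← sub_neg, expand, form_ball_mob γ b A hz, mem_gdisk,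
      mul_neg_iff_right_neg (inv_pos.2 (normSq_pos_of_ne hz))]
  have hself : p ∉ gdisk p γ β (Complex.normSq B) := by
    rw [mem_gdisk]; simpa using hBpos.le
  have hsub' : gdisk p γ β (Complex.normSq B) ⊆ rightRegion := by
    intro z hz
    have hzp : z ≠ p := by rintro rfl; exact hself hz
    obtain ⟨w, hw, hwz⟩ := hsub ((memD z hzp).2 hz)
    have := congrArg (mobInv A B p) hwz
    rw [mobInv_mob A p hB hzp, mobInv_mob A p hB (ne_of_re_nonneg hp hw.1.le)] at this
    rwa [← this]
  have hγpos : 0 < γ := by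
    by_contra! h
    obtain ⟨z, hz, hz'⟩ := exists_notMem_rightRegion (B := B) hp h hβ0
    exact hz' (hsub' hz)
  have hs : 0 < r * ‖B‖ := mul_pos hr (norm_pos_iff.2 hB)
  have hdisc : Complex.normSq β - γ * Complex.normSq B = (r * ‖B‖) ^ 2 := by
    rw [hβ, Complex.normSq_mul, Complex.normSq_conj, mul_pow, ← Complex.normSq_eq_norm_sq, hγ]
    ring
  have hcl : ∀ j, ∃ z, z ≠ p ∧ z ∈ closedGdisk p γ β (Complex.normSq B) ∧
      mob A B p z ∈ closedStdTriple A B p j := by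
    intro j
    obtain ⟨q, hq⟩ := htan j
    have hq' : q ∈ closure (Metric.ball c r) ∩ closure (stdTriple A B p j) := by
      rw [hq]; rfl
    rw [closure_ball _ hr.ne', closure_stdTriple hB hp.toIsWeakPole] at hq'
    obtain ⟨h1, h2⟩ := hq'
    rw [mem_closedBall_iff_normSq hr, ← sub_nonpos, expand] at h1
    have hqA : q ≠ A := by
      rintro rfl
      simp at h1
      linarith
    refine ⟨mobInv A B p q, mobInv_ne A p hB hqA, ?_, by rwa [mob_mobInv A p hB hqA]⟩
    have hzp := mobInv_ne A p hB hqA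
    rw [← mob_mobInv A p hB hqA, form_ball_mob γ b A hzp] at h1
    rw [mem_closedGdisk]
    by_contra! h3
    linarith [mul_pos (inv_pos.2 (normSq_pos_of_ne hzp)) h3]
  rw [gdisk_eq_ball p hγpos hs hdisc] at hsub' memD
  rw [closedGdisk_eq_closedBall p hγpos hs hdisc] at hcl
  have hρ := div_pos hs hγpos
  obtain ⟨he, hρ2⟩ := ball_eq_of_subset_rightRegion hρ hsub'
    (by
      obtain ⟨z, hz, h1, h2⟩ := hcl 0
      exact ⟨z, h1, (mob_mem_closedStdTriple_zero hB hz).1 h2⟩)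
    (by
      obtain ⟨z, hz, h1, h2⟩ := hcl 1
      exact ⟨z, h1, (mob_mem_closedStdTriple_one hB hz).1 h2⟩)
    (by
      obtain ⟨z, hz, h1, h2⟩ := hcl 2
      exact ⟨z, h1, (mob_mem_closedStdTriple_two hB hz).1 h2⟩)
  rw [he, hρ2] at memD
  ext v
  by_cases hv : v = A
  · subst hv
    refine iff_of_false hAD fun h => ?_
    have := subset_closure h
    rw [closure_stdTriple hB hp.sub_one.toIsWeakPole] at this
    exact self_notMem_closedStdTriple_one hB this
  · have hz := mobInv_ne A p hB hv
    rw [← mob_mobInv A p hB hv, memD _ hz]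
    generalize mobInv A B p v = z at *
    have hz' : z - 1 ≠ p - 1 := fun h => hz (sub_left_injective h)
    have := mob_add_one A B p (z - 1)
    rw [sub_add_cancel] at this
    rw [this, mob_mem_stdTriple_one hB hz', mem_ball_iff_normSq (by norm_num),
      Complex.normSq_apply, Complex.normSq_apply]
    simp only [Complex.sub_re, Complex.sub_im, Complex.add_re, Complex.add_im, Complex.one_re,
      Complex.one_im, Complex.div_ofNat_re, Complex.div_ofNat_im, Complex.I_re, Complex.I_im]
    constructor <;> intro h <;> linarith

theorem Din_stdTriple (hB : B ≠ 0) (hp : IsPole p) :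
    Din (stdTriple A B p) = stdTriple A B (p - 1) 1 :=
  eq_of_isInscribedDisk hB hp
    (Classical.epsilon_spec (p := IsInscribedDisk (stdTriple A B p))
      ⟨_, isInscribedDisk_stdTriple hB hp⟩)

end

/-- The three regions which `mob A B p` sends to the members of `stdTriple A B p`. -/
def side : Fin 3 → Set ℂ :=
  ![{z | 1 < z.im}, {z | Complex.normSq z < z.im}, {z | z.im < 0}]

theorem mem_side_zero {z : ℂ} : z ∈ side 0 ↔ 1 < z.im := Iff.rfl

theorem mem_side_one {z : ℂ} : z ∈ side 1 ↔ Complex.normSq z < z.im := Iff.rfl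

theorem mem_side_two {z : ℂ} : z ∈ side 2 ↔ z.im < 0 := Iff.rfl

/-- The Möbius map fixing `s` and sending `∞` to `s + 1`. -/
noncomputable def cuspMap (s z : ℂ) : ℂ := s + 1 - 1 / (z - s + 1)

/-- The reference maps `z ↦ z / (z + 1)`, `z ↦ z + 1` and
`z ↦ i + (z - i) / (z - i + 1)` describing the passage to the inscribed disk. -/
noncomputable def refMap : Fin 3 → ℂ → ℂ :=
  ![cuspMap 0, fun z => z + 1, cuspMap Complex.I]

theorem one_div_re (y : ℂ) : (1 / y).re = y.re / Complex.normSq y := by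
  simp [Complex.inv_re]

theorem one_div_im (y : ℂ) : (1 / y).im = -(y.im / Complex.normSq y) := by
  simp [Complex.inv_im, neg_div]

theorem cuspMap_re_nonneg {s z : ℂ} (hs : s.re = 0) (hz : 0 ≤ z.re) : 0 ≤ (cuspMap s z).re := by
  rw [cuspMap, Complex.sub_re, one_div_re]
  simp only [Complex.add_re, Complex.sub_re, Complex.one_re, hs, zero_add, sub_zero]
  rw [sub_nonneg, div_le_one₀ (Complex.normSq_pos.2 ?_), Complex.normSq_apply]
  · simp [hs]; nlinarith [mul_self_nonneg (z.im - s.im)]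
  · intro h
    have := congrArg Complex.re h
    simp [hs] at this
    linarith

theorem refMap_re_nonneg (j : Fin 3) {z : ℂ} (hz : 0 ≤ z.re) : 0 ≤ (refMap j z).re := by
  fin_cases j
  · exact cuspMap_re_nonneg rfl hz
  · change 0 ≤ (z + 1).re
    rw [Complex.add_re, Complex.one_re]; linarith
  · exact cuspMap_re_nonneg rfl hz

theorem cuspMap_zero_mem_side {z : ℂ} (h : z - 0 + 1 ≠ 0) :
    (cuspMap 0 z - 1 ∈ side 1 ↔ z ∈ side 0) ∧ (cuspMap 0 z ∈ side 1 ↔ z ∈ side 1) ∧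
      (cuspMap 0 z ∈ side 2 ↔ z ∈ side 2) := by
  have hy := Complex.normSq_pos.2 h
  rw [mem_side_zero, mem_side_one, mem_side_one, mem_side_one, mem_side_two, mem_side_two]
  set N := Complex.normSq (z - 0 + 1) with hN
  have e0 : cuspMap 0 z - 1 = -(1 / (z - 0 + 1)) := by unfold cuspMap; ring
  have e1 : cuspMap 0 z = z / (z - 0 + 1) := by
    unfold cuspMap; rw [sub_zero] at h ⊢; field_simp; ring
  have i0 : (cuspMap 0 z - 1).im = z.im / N := by
    rw [e0, Complex.neg_im, one_div_im, neg_neg]; simp [hN]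
  have i1 : (cuspMap 0 z).im = z.im / N := by
    rw [← i0]; simp
  have n0 : Complex.normSq (cuspMap 0 z - 1) = 1 / N := by
    rw [e0, Complex.normSq_neg, Complex.normSq_div, Complex.normSq_one]
  have n1 : Complex.normSq (cuspMap 0 z) = Complex.normSq z / N := by
    rw [e1, Complex.normSq_div]
  rw [n0, n1, i0, i1, div_lt_div_iff_of_pos_right hy, div_lt_div_iff_of_pos_right hy,
    div_lt_iff₀ hy, zero_mul]
  exact ⟨Iff.rfl, Iff.rfl, Iff.rfl⟩

theorem cuspMap_I_mem_side {z : ℂ} (h : z - Complex.I + 1 ≠ 0) :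
    (cuspMap Complex.I z ∈ side 0 ↔ z ∈ side 0) ∧ (cuspMap Complex.I z ∈ side 1 ↔ z ∈ side 1) ∧
      (cuspMap Complex.I z - 1 ∈ side 1 ↔ z ∈ side 2) := by
  have h' : (z - Complex.I) - 0 + 1 ≠ 0 := by rwa [sub_zero]
  have e : cuspMap Complex.I z = cuspMap 0 (z - Complex.I) + Complex.I := by
    unfold cuspMap; simp; ring
  have hy := Complex.normSq_pos.2 h'
  set N := Complex.normSq (z - Complex.I - 0 + 1) with hN
  set u := z - Complex.I with hu
  have e0 : cuspMap 0 u - 1 = -(1 / (u - 0 + 1)) := by unfold cuspMap; ring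
  have e1 : cuspMap 0 u = u / (u - 0 + 1) := by
    unfold cuspMap; rw [sub_zero] at h' ⊢; field_simp; ring
  have i0 : (cuspMap 0 u - 1).im = u.im / N := by
    rw [e0, Complex.neg_im, one_div_im, neg_neg]; simp [hN]
  have i1 : (cuspMap 0 u).im = u.im / N := by
    rw [← i0]; simp
  have n0 : Complex.normSq (cuspMap 0 u - 1) = 1 / N := by
    rw [e0, Complex.normSq_neg, Complex.normSq_div, Complex.normSq_one]
  have n1 : Complex.normSq (cuspMap 0 u) = Complex.normSq u / N := by
    rw [e1, Complex.normSq_div]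
  have nI : ∀ a : ℂ, Complex.normSq (a + Complex.I) = Complex.normSq a + 2 * a.im + 1 := by
    intro a; simp [Complex.normSq_apply]; ring
  have hz : z = u + Complex.I := by rw [hu]; ring
  have e2 : cuspMap 0 u + Complex.I - 1 = cuspMap 0 u - 1 + Complex.I := by ring
  rw [mem_side_zero, mem_side_one, mem_side_one, mem_side_zero, mem_side_one, mem_side_two, e, e2,
    hz]
  simp only [nI, Complex.add_im, Complex.I_im, n0, n1, i0, i1]
  have hq : u.im / N * N = u.im := div_mul_cancel₀ _ hy.ne'
  have hr : Complex.normSq u / N * N = Complex.normSq u := div_mul_cancel₀ _ hy.ne'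
  have ht : 1 / N * N = 1 := div_mul_cancel₀ _ hy.ne'
  generalize u.im / N = q at *
  generalize Complex.normSq u / N = r at *
  generalize 1 / N = t at *
  refine ⟨?_, ?_, ?_⟩
  · rw [← hq]; constructor <;> intro h <;> nlinarith
  · rw [← hq, ← hr]; constructor <;> intro h <;> nlinarith
  · rw [← hq]; constructor <;> intro h <;> nlinarith

section

variable {A B p : ℂ}

theorem mob_mem_stdTriple (hB : B ≠ 0) {z : ℂ} (hz : z ≠ p) (k : Fin 3) :
    mob A B p z ∈ stdTriple A B p k ↔ z ∈ side k := by
  fin_cases k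
  · exact mob_mem_stdTriple_zero hB hz
  · exact mob_mem_stdTriple_one hB hz
  · exact mob_mem_stdTriple_two hB hz

theorem self_notMem_stdTriple (k : Fin 3) : A ∉ stdTriple A B p k := by
  fin_cases k <;> simp [stdTriple, gdisk, Complex.normSq_nonneg]

theorem isWeakPole_iff : IsWeakPole p ↔ p.re ≠ 0 ∧ ∀ k, p ∉ side k := by
  simp only [Fin.forall_fin_succ, IsEmpty.forall_iff, and_true]
  change _ ↔ p.re ≠ 0 ∧ p ∉ side 0 ∧ p ∉ side 1 ∧ p ∉ side 2
  rw [mem_side_zero, mem_side_one, mem_side_two, not_lt, not_lt, not_lt]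
  exact ⟨fun h => ⟨h.1, h.3, h.4, h.2⟩, fun h => ⟨h.1, h.2.2.2, h.2.1, h.2.2.1⟩⟩

theorem cuspMap_injective {s z w : ℂ} (h : cuspMap s z = cuspMap s w) : z = w := by
  unfold cuspMap at h
  simpa using h

theorem mob_cuspMap {s z : ℂ} (hD : 1 + s - p ≠ 0) (hz : z - s + 1 ≠ 0)
    (hzp : z ≠ s - 1 + 1 / (1 + s - p)) :
    mob A B p (cuspMap s z) =
      mob (A + B / (1 + s - p)) (B / (1 + s - p) ^ 2) (s - 1 + 1 / (1 + s - p)) z := by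
  unfold mob cuspMap
  have h1 : z - (s - 1 + 1 / (1 + s - p)) ≠ 0 := sub_ne_zero.2 hzp
  set D := 1 + s - p with hDdef
  set y := z - s + 1 with hy
  have e1 : z - (s - 1 + 1 / D) = (D * y - 1) / D := by
    rw [hy]; field_simp; ring
  have e2 : s + 1 - 1 / y - p = (D * y - 1) / y := by
    rw [hDdef]; field_simp; ring
  rw [e1] at h1 ⊢
  rw [e2]
  have h2 : D * y - 1 ≠ 0 := fun h => h1 (by rw [h, zero_div])
  field_simp
  ring

theorem cuspMap_pole {s : ℂ} : cuspMap s (s - 1 + 1 / (1 + s - p)) = p := by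
  unfold cuspMap
  have e : s - 1 + 1 / (1 + s - p) - s + 1 = 1 / (1 + s - p) := by ring
  rw [e, one_div_one_div]
  ring

theorem eq_stdTriple_of_cuspMap {s : ℂ} (hs : s.re = 0) (hB : B ≠ 0) (hp : IsPole p)
    {𝒟 : Fin 3 → Set ℂ} (hA : ∀ k, A ∉ 𝒟 k) (hA' : ∀ k, A + B / (1 + s - p) ∉ 𝒟 k)
    (hside : ∀ k, s - 1 ∉ side k)
    (h : ∀ k z, z - s + 1 ≠ 0 → cuspMap s z ≠ p → (mob A B p (cuspMap s z) ∈ 𝒟 k ↔ z ∈ side k)) :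
    𝒟 = stdTriple (A + B / (1 + s - p)) (B / (1 + s - p) ^ 2) (s - 1 + 1 / (1 + s - p)) := by
  have hpr := hp.re_neg
  have hD : 1 + s - p ≠ 0 := by
    intro h
    have := congrArg Complex.re h
    simp [hs] at this
    linarith
  have hB' : B / (1 + s - p) ^ 2 ≠ 0 := div_ne_zero hB (pow_ne_zero 2 hD)
  funext k
  ext v
  by_cases h1 : v = A + B / (1 + s - p)
  · subst h1
    exact iff_of_false (hA' k) (self_notMem_stdTriple k)
  have hz := mobInv_ne _ (s - 1 + 1 / (1 + s - p)) hB' h1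
  have hv := mob_mobInv _ (s - 1 + 1 / (1 + s - p)) hB' h1
  by_cases h2 : v = A
  · subst h2
    refine iff_of_false (hA k) fun h5 => ?_
    have h6 := (mob_mem_stdTriple (A := v + B / (1 + s - p)) hB' hz k).1 (by rwa [hv])
    refine hside k ?_
    convert h6 using 1
    rw [mobInv, sub_add_cancel_left]
    field_simp
    ring
  have h3 : mobInv (A + B / (1 + s - p)) (B / (1 + s - p) ^ 2) (s - 1 + 1 / (1 + s - p)) v - s + 1
      ≠ 0 := by
    intro h3
    apply h2
    have h4 : mobInv (A + B / (1 + s - p)) (B / (1 + s - p) ^ 2) (s - 1 + 1 / (1 + s - p)) v =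
        s - 1 := by linear_combination h3
    rw [h4] at hv
    rw [← hv]
    unfold mob
    field_simp
    ring
  rw [← hv, mob_mem_stdTriple hB' hz, ← mob_cuspMap hD h3 hz]
  refine h k _ h3 fun h4 => hz ?_
  exact cuspMap_injective (h4.trans cuspMap_pole.symm)

theorem isPole_cuspMap {s : ℂ} (hs : s.re = 0) (hp : IsPole p)
    (h : ∀ k, s - 1 + 1 / (1 + s - p) ∉ side k) : IsPole (s - 1 + 1 / (1 + s - p)) := by
  have hpr := hp.re_neg
  have h1 : (s - 1 + 1 / (1 + s - p)).re < 0 := by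
    rw [Complex.add_re, one_div_re, Complex.normSq_apply]
    simp only [Complex.add_re, Complex.sub_re, Complex.one_re, hs, Complex.add_im, Complex.sub_im,
      Complex.one_im]
    have h2 : (1 + 0 - p.re) / ((1 + 0 - p.re) * (1 + 0 - p.re) +
        (0 + s.im - p.im) * (0 + s.im - p.im)) < 1 := by
      rw [div_lt_one₀] <;> nlinarith [mul_self_nonneg (0 + s.im - p.im)]
    linarith
  exact ⟨isWeakPole_iff.2 ⟨h1.ne, h⟩, h1⟩

theorem cusp_denom_ne {s : ℂ} (hs : s.re = 0) (hp : IsPole p) : 1 + s - p ≠ 0 := by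
  intro h
  have := congrArg Complex.re h
  simp [hs] at this
  linarith [hp.re_neg]

theorem cusp_pole_denom_ne {s : ℂ} (hs : s.re = 0) (hp : IsPole p) :
    s - 1 + 1 / (1 + s - p) - s + 1 ≠ 0 := by
  have := cusp_denom_ne hs hp
  have e : s - 1 + 1 / (1 + s - p) - s + 1 = 1 / (1 + s - p) := by ring
  rw [e]
  exact one_div_ne_zero this

theorem mob_cuspMap_of_re_nonneg {s z : ℂ} (hs : s.re = 0) (hp : IsPole p)
    (hp' : IsPole (s - 1 + 1 / (1 + s - p))) (hz : 0 ≤ z.re) :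
    mob A B p (cuspMap s z) =
      mob (A + B / (1 + s - p)) (B / (1 + s - p) ^ 2) (s - 1 + 1 / (1 + s - p)) z := by
  refine mob_cuspMap (cusp_denom_ne hs hp) ?_ (ne_of_re_nonneg hp' hz)
  intro h
  have := congrArg Complex.re h
  simp [hs] at this
  linarith

theorem mob_add_one_cusp {s : ℂ} : A + B / (1 + s - p) = mob A B p (s + 1) := by
  unfold mob; rw [add_comm s]

theorem Phi_zero_stdTriple (hB : B ≠ 0) (hp : IsPole p) :
    IsPole (0 - 1 + 1 / (1 + 0 - p)) ∧ Phi 0 (stdTriple A B p) =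
      stdTriple (A + B / (1 + 0 - p)) (B / (1 + 0 - p) ^ 2) (0 - 1 + 1 / (1 + 0 - p)) := by
  have hw := isWeakPole_iff.1 hp.toIsWeakPole
  have hw' := isWeakPole_iff.1 hp.sub_one.toIsWeakPole
  have hne := cusp_pole_denom_ne (s := 0) rfl hp
  obtain ⟨c0, c1, c2⟩ := cuspMap_zero_mem_side hne
  rw [cuspMap_pole] at c0 c1 c2
  have hpole : IsPole (0 - 1 + 1 / (1 + 0 - p)) := by
    refine isPole_cuspMap rfl hp fun k => ?_
    fin_cases k
    · exact mt c0.2 (hw'.2 1)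
    · exact mt c1.2 (hw.2 1)
    · exact mt c2.2 (hw.2 2)
  refine ⟨hpole, eq_stdTriple_of_cuspMap rfl hB hp ?_ ?_ ?_ ?_⟩
  any_goals
    rw [Phi, Din_stdTriple hB hp]
  · intro k
    fin_cases k
    · exact self_notMem_stdTriple 1
    · exact self_notMem_stdTriple 1
    · exact self_notMem_stdTriple 2
  · rw [mob_add_one_cusp]
    intro k
    have h1 : (0 + 1 : ℂ) ≠ p := ne_of_re_nonneg hp (by simp)
    have h2 : (0 : ℂ) ≠ p - 1 := ne_of_re_nonneg hp.sub_one (by simp)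
    fin_cases k
    · change mob A B p (0 + 1) ∉ stdTriple A B (p - 1) 1
      rw [mob_add_one, mob_mem_stdTriple hB h2, mem_side_one]
      simp
    · change mob A B p (0 + 1) ∉ stdTriple A B p 1
      rw [mob_mem_stdTriple hB h1, mem_side_one]
      simp
    · change mob A B p (0 + 1) ∉ stdTriple A B p 2
      rw [mob_mem_stdTriple hB h1, mem_side_two]
      simp
  · intro k
    fin_cases k
    · simp [side]
    · simp [side]
    · simp [side]
  · intro k z hz hzp
    obtain ⟨c0, c1, c2⟩ := cuspMap_zero_mem_side hz
    fin_cases k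
    · change mob A B p (cuspMap 0 z) ∈ stdTriple A B (p - 1) 1 ↔ z ∈ side 0
      have e := mob_add_one A B p (cuspMap 0 z - 1)
      rw [sub_add_cancel] at e
      rw [e, mob_mem_stdTriple hB (fun h => hzp (sub_left_injective h)), c0]
    · exact (mob_mem_stdTriple hB hzp 1).trans c1
    · exact (mob_mem_stdTriple hB hzp 2).trans c2

theorem Phi_two_stdTriple (hB : B ≠ 0) (hp : IsPole p) :
    IsPole (Complex.I - 1 + 1 / (1 + Complex.I - p)) ∧ Phi 2 (stdTriple A B p) =
      stdTriple (A + B / (1 + Complex.I - p)) (B / (1 + Complex.I - p) ^ 2)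
        (Complex.I - 1 + 1 / (1 + Complex.I - p)) := by
  have hw := isWeakPole_iff.1 hp.toIsWeakPole
  have hw' := isWeakPole_iff.1 hp.sub_one.toIsWeakPole
  have hne := cusp_pole_denom_ne (s := Complex.I) rfl hp
  obtain ⟨c0, c1, c2⟩ := cuspMap_I_mem_side hne
  rw [cuspMap_pole] at c0 c1 c2
  have hpole : IsPole (Complex.I - 1 + 1 / (1 + Complex.I - p)) := by
    refine isPole_cuspMap rfl hp fun k => ?_
    fin_cases k
    · exact mt c0.2 (hw.2 0)
    · exact mt c1.2 (hw.2 1)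
    · exact mt c2.2 (hw'.2 1)
  refine ⟨hpole, eq_stdTriple_of_cuspMap rfl hB hp ?_ ?_ ?_ ?_⟩
  any_goals
    rw [Phi, Din_stdTriple hB hp]
  · intro k
    fin_cases k
    · exact self_notMem_stdTriple 0
    · exact self_notMem_stdTriple 1
    · exact self_notMem_stdTriple 1
  · rw [mob_add_one_cusp]
    intro k
    have h1 : (Complex.I + 1 : ℂ) ≠ p := ne_of_re_nonneg hp (by simp)
    have h2 : Complex.I ≠ p - 1 := ne_of_re_nonneg hp.sub_one (by simp)
    fin_cases k
    · change mob A B p (Complex.I + 1) ∉ stdTriple A B p 0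
      rw [mob_mem_stdTriple hB h1, mem_side_zero]
      simp
    · change mob A B p (Complex.I + 1) ∉ stdTriple A B p 1
      rw [mob_mem_stdTriple hB h1, mem_side_one, Complex.normSq_apply]
      simp
    · change mob A B p (Complex.I + 1) ∉ stdTriple A B (p - 1) 1
      rw [mob_add_one, mob_mem_stdTriple hB h2, mem_side_one]
      simp
  · intro k
    fin_cases k
    · simp [side]
    · simp [side, Complex.normSq_apply]
    · simp [side]
  · intro k z hz hzp
    obtain ⟨c0, c1, c2⟩ := cuspMap_I_mem_side hz
    fin_cases k
    · exact (mob_mem_stdTriple hB hzp 0).trans c0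
    · exact (mob_mem_stdTriple hB hzp 1).trans c1
    · change mob A B p (cuspMap Complex.I z) ∈ stdTriple A B (p - 1) 1 ↔ z ∈ side 2
      have e := mob_add_one A B p (cuspMap Complex.I z - 1)
      rw [sub_add_cancel] at e
      rw [e, mob_mem_stdTriple hB (fun h => hzp (sub_left_injective h)), c2]

theorem exists_Phi_stdTriple (j : Fin 3) (hB : B ≠ 0) (hp : IsPole p) :
    ∃ A' B' p', B' ≠ 0 ∧ IsPole p' ∧ Phi j (stdTriple A B p) = stdTriple A' B' p' ∧
      ∀ z : ℂ, 0 ≤ z.re → mob A B p (refMap j z) = mob A' B' p' z := by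
  fin_cases j
  · obtain ⟨h1, h2⟩ := Phi_zero_stdTriple (A := A) hB hp
    exact ⟨_, _, _, div_ne_zero hB (pow_ne_zero 2 (cusp_denom_ne rfl hp)), h1, h2,
      fun z hz => mob_cuspMap_of_re_nonneg rfl hp h1 hz⟩
  · refine ⟨A, B, p - 1, hB, hp.sub_one, ?_, fun z _ => mob_add_one A B p z⟩
    change Phi 1 _ = _
    rw [Phi, Din_stdTriple hB hp]
    funext k
    fin_cases k
    · exact stdTriple_sub_one_zero.symm
    · rfl
    · exact stdTriple_sub_one_two.symm
  · obtain ⟨h1, h2⟩ := Phi_two_stdTriple (A := A) hB hp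
    exact ⟨_, _, _, div_ne_zero hB (pow_ne_zero 2 (cusp_denom_ne rfl hp)), h1, h2,
      fun z hz => mob_cuspMap_of_re_nonneg rfl hp h1 hz⟩

end

/-- The preimages under `mob` of the removed disks. -/
noncomputable def refDisk : Word → Set ℂ
  | [] => {z | Complex.normSq (z - 1) < z.im}
  | j :: w => refMap j '' refDisk w

theorem refDisk_re_nonneg (w : Word) {z : ℂ} (hz : z ∈ refDisk w) : 0 ≤ z.re := by
  induction w generalizing z with
  | nil =>
    have hz' : Complex.normSq (z - 1) < z.im := hz
    rw [Complex.normSq_apply] at hz'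
    simp at hz'
    nlinarith [sq_nonneg (z.im - 1 / 2)]
  | cons j w ih =>
    obtain ⟨y, hy, rfl⟩ := hz
    exact refMap_re_nonneg j (ih hy)

theorem Din_applyWord_stdTriple (w : Word) {A B p : ℂ} (hB : B ≠ 0) (hp : IsPole p) :
    Din (applyWord (stdTriple A B p) w) = mob A B p '' refDisk w := by
  induction w generalizing A B p with
  | nil =>
    change Din (stdTriple A B p) = _
    rw [Din_stdTriple hB hp]
    ext v
    have key : ∀ z, z ≠ p → (mob A B p z ∈ stdTriple A B (p - 1) 1 ↔ z ∈ refDisk []) := by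
      intro z hz
      have e := mob_add_one A B p (z - 1)
      rw [sub_add_cancel] at e
      rw [e, mob_mem_stdTriple hB (fun h => hz (sub_left_injective h)), mem_side_one]
      simp [refDisk]
    constructor
    · intro hv
      have hvA : v ≠ A := by rintro rfl; exact self_notMem_stdTriple 1 hv
      have hz := mobInv_ne A p hB hvA
      refine ⟨mobInv A B p v, ?_, mob_mobInv A p hB hvA⟩
      rwa [← key _ hz, mob_mobInv A p hB hvA]
    · rintro ⟨z, hz, rfl⟩
      exact (key z (ne_of_re_nonneg hp (refDisk_re_nonneg [] hz))).2 hz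
  | cons j w ih =>
    change Din (applyWord (Phi j (stdTriple A B p)) w) = _
    obtain ⟨A', B', p', hB', hp', h1, h2⟩ := exists_Phi_stdTriple (A := A) j hB hp
    rw [h1, ih hB' hp', refDisk, Set.image_image]
    exact Set.image_congr fun z hz => (h2 z (refDisk_re_nonneg w hz)).symm

/-- The preimage under `mob` of the gasket, apart from the point at infinity. -/
noncomputable def refGasket : Set ℂ := closure rightRegion \ ⋃ w, refDisk w

theorem refGasket_re_nonneg {z : ℂ} (hz : z ∈ refGasket) : 0 ≤ z.re := by
  have : closure rightRegion ⊆ {z | 0 ≤ z.re} :=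
    closure_minimal (fun z hz => hz.1.le) (isClosed_le continuous_const Complex.continuous_re)
  exact this hz.1

theorem AG_stdTriple {A B p : ℂ} (hB : B ≠ 0) (hp : IsPole p) :
    AG (stdTriple A B p) \ {A} = mob A B p '' refGasket := by
  rw [AG, idealTriangle_stdTriple hB hp]
  simp only [Din_applyWord_stdTriple _ hB hp]
  have hne : ∀ {z : ℂ}, 0 ≤ z.re → z ≠ p := fun h => ne_of_re_nonneg hp h
  have hre : ∀ {z : ℂ}, z ∈ closure rightRegion → 0 ≤ z.re := by
    intro z hz
    exact closure_minimal (fun z hz => hz.1.le)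
      (isClosed_le continuous_const Complex.continuous_re) hz
  ext v
  constructor
  · rintro ⟨⟨h1, h2⟩, h3⟩
    have h3' : v ≠ A := h3
    refine ⟨mobInv A B p v, ⟨?_, ?_⟩, mob_mobInv A p hB h3'⟩
    · have := (mobInv_continuousAt (B := B) A p h3').continuousWithinAt.mem_closure_image h1
      convert this using 2
      rw [Set.image_image]
      ext z
      constructor
      · intro hz
        exact ⟨z, hz, mobInv_mob A p hB (hne hz.1.le)⟩
      · rintro ⟨y, hy, rfl⟩
        change mobInv A B p (mob A B p y) ∈ rightRegion
        rwa [mobInv_mob A p hB (hne hy.1.le)]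
    · intro h4
      obtain ⟨w, hw⟩ := Set.mem_iUnion.1 h4
      exact h2 (Set.mem_iUnion.2 ⟨w, _, hw, mob_mobInv A p hB h3'⟩)
  · rintro ⟨z, ⟨h1, h2⟩, rfl⟩
    refine ⟨⟨?_, ?_⟩, mob_ne A p hB (hne (hre h1))⟩
    · exact (mob_continuousAt A p (hne (hre h1))).continuousWithinAt.mem_closure_image h1
    · intro h4
      obtain ⟨w, y, hy, hyz⟩ := Set.mem_iUnion.1 h4
      have := congrArg (mobInv A B p) hyz
      rw [mobInv_mob A p hB (hne (refDisk_re_nonneg w hy)), mobInv_mob A p hB (hne (hre h1))]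
        at this
      subst this
      exact h2 (Set.mem_iUnion.2 ⟨w, hy⟩)

theorem gdisk_shift (A A' : ℂ) (a : ℝ) (b : ℂ) (c : ℝ) :
    gdisk A a b c = gdisk A' a (b + a * (A' - A))
      (a * Complex.normSq (A' - A) + 2 * (b * (starRingEnd ℂ) (A' - A)).re + c) := by
  ext v
  rw [mem_gdisk, mem_gdisk]
  simp only [Complex.normSq_apply, Complex.add_re, Complex.add_im, Complex.sub_re, Complex.sub_im,
    Complex.mul_re, Complex.mul_im, Complex.conj_re, Complex.conj_im, Complex.ofReal_re,
    Complex.ofReal_im]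
  constructor <;> intro h <;> linarith

theorem disc_shift (A A' : ℂ) (a : ℝ) (b : ℂ) (c : ℝ) :
    Complex.normSq (b + a * (A' - A)) -
      a * (a * Complex.normSq (A' - A) + 2 * (b * (starRingEnd ℂ) (A' - A)).re + c) =
    Complex.normSq b - a * c := by
  simp only [Complex.normSq_apply, Complex.add_re, Complex.add_im, Complex.sub_re, Complex.sub_im,
    Complex.mul_re, Complex.mul_im, Complex.conj_re, Complex.conj_im, Complex.ofReal_re,
    Complex.ofReal_im]
  ring

theorem gdisk_smul (A : ℂ) {n : ℝ} (hn : 0 < n) (a : ℝ) (b : ℂ) (c : ℝ) :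
    gdisk A (n * a) (n * b) (n * c) = gdisk A a b c := by
  ext v
  have e : n * a * Complex.normSq (v - A) + 2 * (n * b * (starRingEnd ℂ) (v - A)).re + n * c =
      n * (a * Complex.normSq (v - A) + 2 * (b * (starRingEnd ℂ) (v - A)).re + c) := by
    rw [mul_assoc (n : ℂ), Complex.re_ofReal_mul]; ring
  rw [mem_gdisk, mem_gdisk, e, mul_neg_iff_right_neg hn]

theorem exists_gdisk_eq (A : ℂ) {D : Set ℂ} (h : IsOpenDisk D ∨ IsOpenHalfPlane D) :
    ∃ b c, 0 ≤ curv D ∧ Complex.normSq b - curv D * c = 1 ∧ D = gdisk A (curv D) b c := by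
  suffices ∃ a b c, 0 ≤ a ∧ Complex.normSq b - a * c = 1 ∧ D = gdisk A a b c by
    obtain ⟨a, b, c, ha, hd, rfl⟩ := this
    rw [curv_gdisk A ha one_pos (by rw [hd, one_pow]), div_one]
    exact ⟨b, c, ha, hd, rfl⟩
  suffices ∃ a b c, 0 ≤ a ∧ Complex.normSq b - a * c = 1 ∧ D = gdisk 0 a b c by
    obtain ⟨a, b, c, ha, hd, hD⟩ := this
    exact ⟨a, _, _, ha, (disc_shift 0 A a b c).trans hd, hD.trans (gdisk_shift 0 A a b c)⟩
  rcases h with ⟨z, r, hr, rfl⟩ | ⟨α, hα, c, rfl⟩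
  · have hd : Complex.normSq (-((r⁻¹ : ℝ) : ℂ) * z) -
        r⁻¹ * (r⁻¹ * (Complex.normSq z - r ^ 2)) = 1 := by
      rw [Complex.normSq_mul, Complex.normSq_neg, Complex.normSq_ofReal]
      field_simp
      ring
    refine ⟨r⁻¹, _, _, (inv_pos.2 hr).le, hd, ?_⟩
    rw [gdisk_eq_ball 0 (inv_pos.2 hr) one_pos (by rw [hd, one_pow])]
    congr 1
    · have : (r : ℂ) ≠ 0 := by exact_mod_cast hr.ne'
      push_cast
      field_simp
      ring
    · simp
  · have hα' : 0 < ‖α‖ := norm_pos_iff.2 hα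
    refine ⟨0, ((‖α‖⁻¹ : ℝ) : ℂ) * (starRingEnd ℂ) α, ‖α‖⁻¹ * (-2 * c), le_rfl, ?_, ?_⟩
    · rw [Complex.normSq_mul, Complex.normSq_ofReal, Complex.normSq_conj,
        Complex.normSq_eq_norm_sq]
      field_simp
      ring
    · have := gdisk_smul 0 (inv_pos.2 hα') 0 ((starRingEnd ℂ) α) (-2 * c)
      rw [mul_zero] at this
      rw [this, gdisk_zero_eq]
      ext v
      rw [Set.mem_ofPred_eq, Set.mem_ofPred_eq, Complex.conj_conj, mul_assoc, Complex.mul_re 2,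
        map_zero, mul_zero, Complex.zero_re, Complex.re_ofNat, Complex.im_ofNat]
      constructor <;> intro h <;> linarith

theorem disjoint_of_closure_inter_eq {D₁ D₂ : Set ℂ} (h1 : IsOpen D₁) (h2 : IsOpen D₂) {q : ℂ}
    (h : closure D₁ ∩ closure D₂ = {q}) : D₁ ∩ D₂ = ∅ := by
  have hsub : D₁ ∩ D₂ ⊆ {q} := by
    rw [← h]
    exact Set.inter_subset_inter subset_closure subset_closure
  rcases Set.subset_singleton_iff_eq.1 hsub with h3 | h3
  · exact h3
  · have := h1.inter h2
    rw [h3] at this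
    exact absurd this (not_isOpen_singleton q)

theorem form_eq_zero_of_tangent {A : ℂ} {a₁ a₂ : ℝ} {b₁ b₂ : ℂ} {c₁ c₂ : ℝ} {q : ℂ}
    (ha₁ : 0 ≤ a₁) (h1 : Complex.normSq b₁ - a₁ * c₁ = 1)
    (h : closure (gdisk A a₁ b₁ c₁) ∩ closure (gdisk A a₂ b₂ c₂) = {q}) :
    a₁ * Complex.normSq (q - A) + 2 * (b₁ * (starRingEnd ℂ) (q - A)).re + c₁ = 0 := by
  have hq : q ∈ closure (gdisk A a₁ b₁ c₁) ∩ closure (gdisk A a₂ b₂ c₂) := by rw [h]; rfl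
  have hdis := disjoint_of_closure_inter_eq (isOpen_gdisk _ _ _ _) (isOpen_gdisk _ _ _ _) h
  have hq1 := hq.1
  rw [closure_gdisk A ha₁ one_pos (by rw [h1, one_pow]), mem_closedGdisk] at hq1
  refine hq1.antisymm ?_
  by_contra! hlt
  obtain ⟨y, hy1, hy2⟩ := mem_closure_iff.1 hq.2 _ (isOpen_gdisk A a₁ b₁ c₁) hlt
  have : y ∈ gdisk A a₁ b₁ c₁ ∩ gdisk A a₂ b₂ c₂ := ⟨hy1, hy2⟩
  rw [hdis] at this
  exact this

theorem add_eq_zero_of_tangent {q : ℂ} {a₁ a₂ : ℝ} {b₁ b₂ : ℂ}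
    (h1 : Complex.normSq b₁ = 1) (h2 : Complex.normSq b₂ = 1)
    (h : gdisk q a₁ b₁ 0 ∩ gdisk q a₂ b₂ 0 = ∅) : b₁ + b₂ = 0 := by
  by_contra hu
  have hN := Complex.normSq_pos.2 hu
  have hmem : ∀ {a : ℝ} {b : ℂ} (t : ℝ), 0 < t → (|a₁| + |a₂| + 1) * t < 1 →
      |a| ≤ |a₁| + |a₂| → 2 * (b * (starRingEnd ℂ) (b₁ + b₂)).re = Complex.normSq (b₁ + b₂) →
      q - t * (b₁ + b₂) ∈ gdisk q a b 0 := by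
    intro a b t ht ht1 ha hb
    have e1 : q - t * (b₁ + b₂) - q = ((-t : ℝ) : ℂ) * (b₁ + b₂) := by push_cast; ring
    have e2 : b * (starRingEnd ℂ) (((-t : ℝ) : ℂ) * (b₁ + b₂)) =
        ((-t : ℝ) : ℂ) * (b * (starRingEnd ℂ) (b₁ + b₂)) := by
      rw [map_mul, Complex.conj_ofReal]; ring
    rw [mem_gdisk, e1, e2, Complex.re_ofReal_mul, Complex.normSq_mul, Complex.normSq_ofReal]
    have e3 : a * (-t * -t * Complex.normSq (b₁ + b₂)) +
        2 * (-t * (b * (starRingEnd ℂ) (b₁ + b₂)).re) + 0 =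
        (t * Complex.normSq (b₁ + b₂)) * (a * t - 1) := by
      linear_combination (-t) * hb
    rw [e3]
    refine mul_neg_of_pos_of_neg (mul_pos ht hN) ?_
    nlinarith [le_abs_self a]
  obtain ⟨t, ht, ht1⟩ : ∃ t : ℝ, 0 < t ∧ (|a₁| + |a₂| + 1) * t < 1 := by
    have hpos : 0 < |a₁| + |a₂| + 1 := by positivity
    refine ⟨(2 * (|a₁| + |a₂| + 1))⁻¹, by positivity, ?_⟩
    field_simp
    norm_num
  have h3 : q - t * (b₁ + b₂) ∈ gdisk q a₁ b₁ 0 ∩ gdisk q a₂ b₂ 0 := by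
    rw [Complex.normSq_apply] at h1 h2
    refine ⟨hmem t ht ht1 (by linarith [abs_nonneg a₂]) ?_,
      hmem t ht ht1 (by linarith [abs_nonneg a₁]) ?_⟩
    · simp [Complex.normSq_apply]; linarith
    · simp [Complex.normSq_apply]; linarith
  rw [h] at h3
  exact h3

theorem tangent_bilin {A : ℂ} {a₁ a₂ : ℝ} {b₁ b₂ : ℂ} {c₁ c₂ : ℝ} {q : ℂ}
    (ha₁ : 0 ≤ a₁) (ha₂ : 0 ≤ a₂) (h1 : Complex.normSq b₁ - a₁ * c₁ = 1)
    (h2 : Complex.normSq b₂ - a₂ * c₂ = 1)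
    (h : closure (gdisk A a₁ b₁ c₁) ∩ closure (gdisk A a₂ b₂ c₂) = {q}) :
    2 * (b₁ * (starRingEnd ℂ) b₂).re - a₁ * c₂ - a₂ * c₁ = -2 := by
  have hdis := disjoint_of_closure_inter_eq (isOpen_gdisk _ _ _ _) (isOpen_gdisk _ _ _ _) h
  have z1 := form_eq_zero_of_tangent ha₁ h1 h
  have z2 := form_eq_zero_of_tangent ha₂ h2 (by rwa [Set.inter_comm])
  rw [gdisk_shift A q a₁, gdisk_shift A q a₂, z1, z2] at hdis
  have d1 := disc_shift A q a₁ b₁ c₁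
  have d2 := disc_shift A q a₂ b₂ c₂
  rw [z1, h1, mul_zero, sub_zero] at d1
  rw [z2, h2, mul_zero, sub_zero] at d2
  have hs := add_eq_zero_of_tangent d1 d2 hdis
  have hr := congrArg Complex.re hs
  have hi := congrArg Complex.im hs
  rw [Complex.normSq_apply] at d1
  simp only [Complex.normSq_apply, Complex.add_re, Complex.add_im, Complex.sub_re, Complex.sub_im,
    Complex.mul_re, Complex.mul_im, Complex.conj_re, Complex.conj_im, Complex.ofReal_re,
    Complex.ofReal_im, Complex.zero_re, Complex.zero_im] at *
  generalize q.re - A.re = x at *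
  generalize q.im - A.im = y at *
  set X := b₁.re + (a₁ * x - 0 * y) with hX
  set Y := b₁.im + (a₁ * y + 0 * x) with hY
  have hX2 : b₂.re + (a₂ * x - 0 * y) = -X := by linarith
  have hY2 : b₂.im + (a₂ * y + 0 * x) = -Y := by linarith
  have e1 : b₁.re = X - a₁ * x := by rw [hX]; ring
  have e2 : b₁.im = Y - a₁ * y := by rw [hY]; ring
  have e3 : b₂.re = -X - a₂ * x := by linarith
  have e4 : b₂.im = -Y - a₂ * y := by linarith
  have e5 : c₁ = -(a₁ * (x * x + y * y)) - 2 * (b₁.re * x - b₁.im * -y) := by linarith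
  have e6 : c₂ = -(a₂ * (x * x + y * y)) - 2 * (b₂.re * x - b₂.im * -y) := by linarith
  rw [e5, e6, e1, e2, e3, e4]
  linear_combination (-2) * d1

/-- The pole `p` for which `stdTriple A B p` has curvatures proportional to `g`. -/
noncomputable def poleOf (g : Fin 4 → ℝ) : ℂ := ⟨-(g 3 / (g 0 + g 2)), g 2 / (g 0 + g 2)⟩

section

variable {g : Fin 4 → ℝ}

theorem Gamma.sq_eq (hg : g ∈ Gamma) : g 3 ^ 2 = g 1 * g 2 + g 2 * g 0 + g 0 * g 1 := by
  obtain ⟨h0, h1, h2, h3, h4⟩ := hg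
  rw [h3, kappa, Real.sq_sqrt (by positivity)]

theorem Gamma.add_pos (hg : g ∈ Gamma) : 0 < g 0 + g 2 := by
  have h := Gamma.sq_eq hg
  obtain ⟨h0, h1, h2, h3, h4⟩ := hg
  by_contra! hn
  have e0 : g 0 = 0 := by linarith
  have e2 : g 2 = 0 := by linarith
  rw [e0, e2] at h
  nlinarith

theorem normSq_poleOf (hg : g ∈ Gamma) :
    Complex.normSq (poleOf g) - (poleOf g).im = g 1 / (g 0 + g 2) := by
  have hn := Gamma.add_pos hg
  rw [Complex.normSq_apply, poleOf]
  field_simp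
  linear_combination Gamma.sq_eq hg

theorem isPole_poleOf (hg : g ∈ Gamma) : IsPole (poleOf g) := by
  have hn := Gamma.add_pos hg
  have hq := normSq_poleOf hg
  obtain ⟨h0, h1, h2, h3, h4⟩ := hg
  have hre : (poleOf g).re < 0 := neg_neg_of_pos (div_pos h4 hn)
  refine ⟨⟨hre.ne, div_nonneg h2 hn.le, (div_le_one₀ hn).2 (by linarith), ?_⟩, hre⟩
  have := div_nonneg h1 hn.le
  linarith

theorem exists_eq_stdTriple (hg : g ∈ Gamma) {𝒟 : Fin 3 → Set ℂ} (h𝒟 : IsTDTplus 𝒟)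
    (c0 : curv (𝒟 0) = g 0) (c1 : curv (𝒟 1) = g 1) (c2 : curv (𝒟 2) = g 2) :
    ∃ A B, ‖B‖ = 2 / (g 0 + g 2) ∧ 𝒟 = stdTriple A B (poleOf g) := by
  have hn := Gamma.add_pos hg
  have hsq := Gamma.sq_eq hg
  obtain ⟨⟨hor, htan⟩, -⟩ := id h𝒟
  have hmem : ∀ j, IsOpenDisk (𝒟 j) ∨ IsOpenHalfPlane (𝒟 j) := by
    intro j
    rcases hor with h | ⟨k, hk, h⟩
    · exact Or.inl (h j)
    · by_cases hjk : j = k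
      · exact Or.inr (hjk ▸ hk)
      · exact Or.inl (h j hjk)
  obtain ⟨A, hA⟩ := htan 0 2 (by decide)
  obtain ⟨b₀, c₀, n0, d0, e0⟩ := exists_gdisk_eq A (hmem 0)
  obtain ⟨b₁, c₁, n1, d1, e1⟩ := exists_gdisk_eq A (hmem 1)
  obtain ⟨b₂, c₂, n2, d2, e2⟩ := exists_gdisk_eq A (hmem 2)
  rw [c0] at n0 d0 e0
  rw [c1] at n1 d1 e1
  rw [c2] at n2 d2 e2
  have hA' := hA
  rw [e0, e2] at hA
  have z0 := form_eq_zero_of_tangent n0 d0 hA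
  have z2 := form_eq_zero_of_tangent n2 d2 (by rwa [Set.inter_comm] at hA)
  simp only [sub_self, map_zero, mul_zero, Complex.zero_re, zero_add] at z0 z2
  subst z0 z2
  obtain ⟨q, hq⟩ := htan 0 1 (by decide)
  obtain ⟨q', hq'⟩ := htan 2 1 (by decide)
  rw [e0, e1] at hq
  rw [e2, e1] at hq'
  have t1 := tangent_bilin n0 n1 d0 d1 hq
  have t2 := tangent_bilin n2 n1 d2 d1 hq'
  rw [mul_zero, sub_zero] at d0 d2 t1 t2
  have hs := add_eq_zero_of_tangent d0 d2 (disjoint_of_closure_inter_eq (isOpen_gdisk _ _ _ _)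
    (isOpen_gdisk _ _ _ _) hA)
  have hb2 : b₂ = -b₀ := (neg_eq_of_add_eq_zero_right hs).symm
  subst hb2
  rw [neg_mul, Complex.neg_re] at t2
  set n := g 0 + g 2 with hndef
  have hc1 : c₁ = 4 / n := by
    rw [eq_div_iff hn.ne']; linarith
  set B : ℂ := ((2 / n : ℝ) : ℂ) * (-Complex.I * b₀) with hB
  have hnB : Complex.normSq B = (2 / n) ^ 2 := by
    rw [hB, Complex.normSq_mul, Complex.normSq_ofReal, Complex.normSq_mul, d0]; simp; ring
  have hBn : ‖B‖ = 2 / n := by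
    have h2n : 0 ≤ 2 / n := by positivity
    rw [Complex.normSq_eq_norm_sq] at hnB
    exact (pow_left_inj₀ (norm_nonneg _) h2n two_ne_zero).1 hnB
  have hB0 : B ≠ 0 := by rw [← norm_pos_iff, hBn]; positivity
  set p : ℂ := (starRingEnd ℂ) (Complex.I / 2 * (b₁ * (starRingEnd ℂ) b₀ - 1)) with hp
  have hpim : p.im = g 2 / n := by
    have : p.im = -(1 / 2 * ((b₀ * (starRingEnd ℂ) b₁).re - 1)) := by
      rw [hp, Complex.conj_im]; simp; ring
    rw [this, eq_div_iff hn.ne']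
    rw [hc1] at t1
    have : (g 0) * (4 / n) * n = 4 * g 0 := by field_simp
    nlinarith
  have hpsq : Complex.normSq p - p.im = g 1 / n := by
    have e3 : Complex.normSq p = 1 / 4 * (Complex.normSq b₁ * Complex.normSq b₀ + 1 -
        2 * (b₀ * (starRingEnd ℂ) b₁).re) := by
      rw [hp, Complex.normSq_conj]
      simp [Complex.normSq_apply]; ring
    rw [e3, hpim, d0, eq_div_iff hn.ne']
    have e4 : g 2 / n * n = g 2 := by field_simp
    have e5 : c₁ * n = 4 := by rw [hc1]; field_simp
    linear_combination (1 / 4) * n * d1 - (1 / 4) * n * t1 - e4 +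
      (1 / 4) * (g 1 - g 0) * e5 + hndef
  have hbc : (starRingEnd ℂ) b₀ * b₀ = 1 := by
    rw [mul_comm, Complex.mul_conj, d0, Complex.ofReal_one]
  have heq : 𝒟 = stdTriple A B p := by
    have hnc : (n : ℂ) ≠ 0 := by exact_mod_cast hn.ne'
    funext k
    fin_cases k
    · change 𝒟 0 = gdisk A (1 - p.im) (Complex.I * B / 2) 0
      rw [e0, ← gdisk_smul A hn (1 - p.im)]
      congr 1
      · rw [hpim]; field_simp; linarith
      · rw [hB]; push_cast; field_simp; linear_combination b₀ * Complex.I_sq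
      · ring
    · change 𝒟 1 = gdisk A (Complex.normSq p - p.im)
        (((starRingEnd ℂ) p + Complex.I / 2) * B) (Complex.normSq B)
      rw [e1, ← gdisk_smul A hn (Complex.normSq p - p.im)]
      congr 1
      · rw [hpsq]; field_simp
      · rw [hB, hp, Complex.conj_conj]; push_cast; field_simp
        linear_combination (-b₁) * hbc + b₁ * (starRingEnd ℂ) b₀ * b₀ * Complex.I_sq
      · rw [hnB, hc1]; field_simp; norm_num
    · change 𝒟 2 = gdisk A p.im (-(Complex.I * B / 2)) 0
      rw [e2, ← gdisk_smul A hn p.im]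
      congr 1
      · rw [hpim]; field_simp
      · rw [hB]; push_cast; field_simp; linear_combination (-b₀) * Complex.I_sq
      · ring
  have hre2 : p.re ^ 2 = (g 3 / n) ^ 2 := by
    have : Complex.normSq p = p.re ^ 2 + p.im ^ 2 := by rw [Complex.normSq_apply]; ring
    rw [div_pow, hsq, eq_div_iff (by positivity)]
    rw [this, hpim] at hpsq
    have e3 : p.re ^ 2 = g 1 / n + g 2 / n - (g 2 / n) ^ 2 := by linarith
    rw [e3]
    field_simp
    rw [hndef]; ring
  have hκ : 0 < g 3 / n := div_pos hg.2.2.2.2 hn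
  have hweak : IsWeakPole p := by
    refine ⟨?_, ?_, ?_, ?_⟩
    · intro h
      rw [h] at hre2
      nlinarith
    · rw [hpim]; positivity
    · rw [hpim, div_le_one₀ hn]; linarith
    · have : 0 ≤ g 1 / n := by positivity
      linarith
  have hneg : p.re < 0 := by
    rw [heq] at h𝒟
    exact (isTDTplus_stdTriple_iff hB0 hweak).1 h𝒟
  have hpp : p = poleOf g := by
    apply Complex.ext
    · change p.re = -(g 3 / n)
      rcases sq_eq_sq_iff_eq_or_eq_neg.1 hre2 with h | h
      · linarith
      · exact h
    · exact hpim
  exact ⟨A, B, hBn, by rw [heq, hpp]⟩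

theorem exists_tripleOf_eq (hg : g ∈ Gamma) :
    ∃ A B, ‖B‖ = 2 / (g 0 + g 2) ∧ tripleOf g = stdTriple A B (poleOf g) := by
  have hn := Gamma.add_pos hg
  have hp := isPole_poleOf hg
  have hnorm : ‖((2 / (g 0 + g 2) : ℝ) : ℂ)‖ = 2 / (g 0 + g 2) := by
    rw [Complex.norm_real, Real.norm_of_nonneg (by positivity)]
  have hB : ((2 / (g 0 + g 2) : ℝ) : ℂ) ≠ 0 := by
    rw [← norm_pos_iff, hnorm]; positivity
  obtain ⟨h1, h2, h3, h4⟩ := Classical.epsilon_spec (p := fun 𝒟 : Fin 3 → Set ℂ =>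
    IsTDTplus 𝒟 ∧ curv (𝒟 0) = g 0 ∧ curv (𝒟 1) = g 1 ∧ curv (𝒟 2) = g 2)
    ⟨stdTriple 0 ((2 / (g 0 + g 2) : ℝ) : ℂ) (poleOf g),
      (isTDTplus_stdTriple_iff hB hp.toIsWeakPole).2 hp.re_neg, by
        rw [curv_stdTriple_zero hB hp.toIsWeakPole, hnorm, poleOf]; field_simp; ring, by
        rw [curv_stdTriple_one hB hp.toIsWeakPole, hnorm, normSq_poleOf hg]; field_simp, by
        rw [curv_stdTriple_two hB hp.toIsWeakPole, hnorm, poleOf]; field_simp⟩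
  exact exists_eq_stdTriple hg h1 h2 h3 h4

end

/-- The quadratic form `(α + γ) |z - p|²`, where `p` is the pole of `g = (α, β, γ, κ)`. -/
def poleForm (z : ℂ) (g : Fin 4 → ℝ) : ℝ :=
  (g 0 + g 2) * Complex.normSq z + 2 * g 3 * z.re - 2 * g 2 * z.im + g 1 + g 2

theorem poleForm_eq (z : ℂ) {g : Fin 4 → ℝ} (hg : g ∈ Gamma) :
    poleForm z g = (g 0 + g 2) * Complex.normSq (z - poleOf g) := by
  have hn := Gamma.add_pos hg
  simp only [poleForm, Complex.normSq_apply, poleOf, Complex.sub_re, Complex.sub_im]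
  field_simp
  linear_combination (-1) * Gamma.sq_eq hg

theorem vecMul_Mmat_zero (g : Fin 4 → ℝ) :
    g ᵥ* Mmat 0 = ![g 0 + g 1 + g 2 + 2 * g 3, g 1, g 2, g 1 + g 2 + g 3] := by
  funext k
  fin_cases k <;> simp [Mmat, Matrix.vecMul, dotProduct, Fin.sum_univ_four]
  ring

theorem vecMul_Mmat_one (g : Fin 4 → ℝ) :
    g ᵥ* Mmat 1 = ![g 0, g 0 + g 1 + g 2 + 2 * g 3, g 2, g 0 + g 2 + g 3] := by
  funext k
  fin_cases k <;> simp [Mmat, Matrix.vecMul, dotProduct, Fin.sum_univ_four]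
  ring

theorem vecMul_Mmat_two (g : Fin 4 → ℝ) :
    g ᵥ* Mmat 2 = ![g 0, g 1, g 0 + g 1 + g 2 + 2 * g 3, g 0 + g 1 + g 3] := by
  funext k
  fin_cases k <;> simp [Mmat, Matrix.vecMul, dotProduct, Fin.sum_univ_four]
  ring

theorem vecMul_Mmat_mem_Gamma (j : Fin 3) {g : Fin 4 → ℝ} (hg : g ∈ Gamma) :
    g ᵥ* Mmat j ∈ Gamma := by
  have hsq := Gamma.sq_eq hg
  obtain ⟨h0, h1, h2, -, h4⟩ := hg
  fin_cases j
  · change g ᵥ* Mmat 0 ∈ Gamma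
    rw [vecMul_Mmat_zero]
    refine ⟨?_, h1, h2, ?_, ?_⟩
    · change 0 ≤ g 0 + g 1 + g 2 + 2 * g 3
      positivity
    · change g 1 + g 2 + g 3 = kappa (g 0 + g 1 + g 2 + 2 * g 3) (g 1) (g 2)
      rw [kappa, eq_comm, Real.sqrt_eq_iff_mul_self_eq_of_pos (by positivity)]
      linear_combination hsq
    · change 0 < g 1 + g 2 + g 3
      positivity
  · change g ᵥ* Mmat 1 ∈ Gamma
    rw [vecMul_Mmat_one]
    refine ⟨h0, ?_, h2, ?_, ?_⟩
    · change 0 ≤ g 0 + g 1 + g 2 + 2 * g 3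
      positivity
    · change g 0 + g 2 + g 3 = kappa (g 0) (g 0 + g 1 + g 2 + 2 * g 3) (g 2)
      rw [kappa, eq_comm, Real.sqrt_eq_iff_mul_self_eq_of_pos (by positivity)]
      linear_combination hsq
    · change 0 < g 0 + g 2 + g 3
      positivity
  · change g ᵥ* Mmat 2 ∈ Gamma
    rw [vecMul_Mmat_two]
    refine ⟨h0, h1, ?_, ?_, ?_⟩
    · change 0 ≤ g 0 + g 1 + g 2 + 2 * g 3
      positivity
    · change g 0 + g 1 + g 3 = kappa (g 0) (g 1) (g 0 + g 1 + g 2 + 2 * g 3)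
      rw [kappa, eq_comm, Real.sqrt_eq_iff_mul_self_eq_of_pos (by positivity)]
      linear_combination hsq
    · change 0 < g 0 + g 1 + g 3
      positivity

theorem Mword_cons (j : Fin 3) (w : Word) : Mword (j :: w) = Mmat j * Mword w := by
  simp [Mword]

theorem vecMul_Mword_mem_Gamma (w : Word) {g : Fin 4 → ℝ} (hg : g ∈ Gamma) :
    g ᵥ* Mword w ∈ Gamma := by
  induction w generalizing g with
  | nil => simpa [Mword] using hg
  | cons j w ih =>
    rw [Mword_cons, ← Matrix.vecMul_vecMul]
    exact ih (vecMul_Mmat_mem_Gamma j hg)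

theorem normSq_cuspMap {s z : ℂ} (h : z - s + 1 ≠ 0) :
    Complex.normSq (z - s + 1) * (cuspMap s z).re =
      Complex.normSq (z - s + 1) * (s.re + 1) - (z - s + 1).re ∧
    Complex.normSq (z - s + 1) * (cuspMap s z).im =
      Complex.normSq (z - s + 1) * s.im + (z - s + 1).im := by
  have hN := (Complex.normSq_pos.2 h).ne'
  rw [cuspMap, Complex.sub_re, Complex.sub_im, one_div_re, one_div_im]
  constructor
  · rw [mul_sub, mul_div_cancel₀ _ hN]; simp
  · rw [mul_sub, mul_neg, mul_div_cancel₀ _ hN]; simp; ring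

theorem poleForm_vecMul_Mmat (j : Fin 3) {z : ℂ} (hz : 0 ≤ z.re) :
    ∃ c : ℝ, 0 < c ∧ ∀ g, poleForm z (g ᵥ* Mmat j) = c * poleForm (refMap j z) g := by
  have hne : ∀ s : ℂ, s.re = 0 → z - s + 1 ≠ 0 := by
    intro s hs h
    have := congrArg Complex.re h
    simp [hs] at this
    linarith
  have hcusp : ∀ s : ℂ, s.re = 0 → Complex.normSq (z - s + 1) *
      Complex.normSq (cuspMap s z) = Complex.normSq (z - s + 1) * (1 + Complex.normSq s) -
        2 * (z - s + 1).re + 2 * s.im * (z - s + 1).im + 1 := by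
    intro s hs
    obtain ⟨e1, e2⟩ := normSq_cuspMap (hne s hs)
    have hN := Complex.normSq_pos.2 (hne s hs)
    have e3 : Complex.normSq (z - s + 1) = (z - s + 1).re ^ 2 + (z - s + 1).im ^ 2 := by
      rw [Complex.normSq_apply]; ring
    have e4 : Complex.normSq s = s.im ^ 2 := by rw [Complex.normSq_apply, hs]; ring
    have e5 : Complex.normSq (cuspMap s z) = (cuspMap s z).re ^ 2 + (cuspMap s z).im ^ 2 := by
      rw [Complex.normSq_apply]; ring
    rw [hs] at e1
    apply mul_left_cancel₀ hN.ne'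
    rw [e4, e5]
    generalize Complex.normSq (z - s + 1) = N at *
    generalize (z - s + 1).re = a at *
    generalize (z - s + 1).im = b at *
    generalize (cuspMap s z).re = X at *
    generalize (cuspMap s z).im = Y at *
    linear_combination (N * X + (N - a)) * e1 + (N * Y + (N * s.im + b)) * e2 - e3
  fin_cases j
  · refine ⟨Complex.normSq (z - 0 + 1), Complex.normSq_pos.2 (hne 0 rfl), fun g => ?_⟩
    change poleForm z (g ᵥ* Mmat 0) = _ * poleForm (cuspMap 0 z) g
    obtain ⟨e1, e2⟩ := normSq_cuspMap (hne 0 rfl)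
    have e3 := hcusp 0 rfl
    rw [vecMul_Mmat_zero]
    change (g 0 + g 1 + g 2 + 2 * g 3 + g 2) * Complex.normSq z + 2 * (g 1 + g 2 + g 3) * z.re -
      2 * g 2 * z.im + g 1 + g 2 = _
    have e4 : Complex.normSq (z - 0 + 1) = Complex.normSq z + 2 * z.re + 1 := by
      simp [Complex.normSq_apply]; ring
    have r1 : (z - 0 + 1).re = z.re + 1 := by simp
    have r2 : (z - 0 + 1).im = z.im := by simp
    rw [r1, e4] at e1 e3
    rw [r2, e4] at e2
    rw [r2] at e3
    simp only [map_zero, Complex.zero_re, Complex.zero_im] at e1 e2 e3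
    rw [e4, poleForm]
    linear_combination (-(g 0 + g 2)) * e3 - 2 * g 3 * e1 + 2 * g 2 * e2
  · refine ⟨1, one_pos, fun g => ?_⟩
    change poleForm z (g ᵥ* Mmat 1) = 1 * poleForm (z + 1) g
    rw [vecMul_Mmat_one]
    change (g 0 + g 2) * Complex.normSq z + 2 * (g 0 + g 2 + g 3) * z.re - 2 * g 2 * z.im +
      (g 0 + g 1 + g 2 + 2 * g 3) + g 2 = _
    simp [poleForm, Complex.normSq_apply]
    ring
  · refine ⟨Complex.normSq (z - Complex.I + 1), Complex.normSq_pos.2 (hne _ rfl), fun g => ?_⟩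
    change poleForm z (g ᵥ* Mmat 2) = _ * poleForm (cuspMap Complex.I z) g
    obtain ⟨e1, e2⟩ := normSq_cuspMap (hne Complex.I rfl)
    have e3 := hcusp Complex.I rfl
    rw [vecMul_Mmat_two]
    change (g 0 + (g 0 + g 1 + g 2 + 2 * g 3)) * Complex.normSq z + 2 * (g 0 + g 1 + g 3) * z.re -
      2 * (g 0 + g 1 + g 2 + 2 * g 3) * z.im + g 1 + (g 0 + g 1 + g 2 + 2 * g 3) = _
    have e4 : Complex.normSq (z - Complex.I + 1) =
        Complex.normSq z + 2 * z.re - 2 * z.im + 2 := by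
      simp [Complex.normSq_apply]; ring
    have r1 : (z - Complex.I + 1).re = z.re + 1 := by simp
    have r2 : (z - Complex.I + 1).im = z.im - 1 := by simp
    rw [r1, e4] at e1 e3
    rw [r2, e4] at e2
    rw [r2] at e3
    simp only [Complex.normSq_I, Complex.I_re, Complex.I_im] at e1 e2 e3
    rw [e4, poleForm]
    linear_combination (-(g 0 + g 2)) * e3 - 2 * g 3 * e1 + 2 * g 2 * e2

theorem poleForm_vecMul_Mword (w : Word) {z : ℂ} (hz : 0 ≤ z.re) :
    ∃ (c : ℝ) (z' : ℂ), 0 < c ∧ 0 ≤ z'.re ∧ ∀ g, poleForm z (g ᵥ* Mword w) = c * poleForm z' g := by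
  induction w with
  | nil => exact ⟨1, z, one_pos, hz, fun g => by simp [Mword]⟩
  | cons j w ih =>
    obtain ⟨c, z', hc, hz', h⟩ := ih
    obtain ⟨c', hc', h'⟩ := poleForm_vecMul_Mmat j hz'
    refine ⟨c * c', refMap j z', mul_pos hc hc', refMap_re_nonneg j hz', fun g => ?_⟩
    rw [Mword_cons, ← Matrix.vecMul_vecMul, h, h', mul_assoc]

section

variable {ε : ℝ} {g h : Fin 4 → ℝ}

theorem GammaEps.sq_eq (hg : g ∈ GammaEps ε) :
    g 3 ^ 2 = g 1 * g 2 + g 2 * g 0 + g 0 * g 1 := by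
  obtain ⟨⟨h0, -⟩, ⟨h1, -⟩, ⟨h2, -⟩, h3, -⟩ := hg
  rw [h3, kappa, Real.sq_sqrt (by positivity)]

theorem GammaEps.le_kappa (hε : 0 < ε) (hg : g ∈ GammaEps ε) : ε / 2 ≤ g 3 := by
  have hsq := GammaEps.sq_eq hg
  obtain ⟨⟨h0, -⟩, ⟨h1, -⟩, ⟨h2, -⟩, h3, h4, h5, h6⟩ := hg
  have h7 : 0 ≤ g 3 := h3 ▸ Real.sqrt_nonneg _
  refine le_of_sq_le_sq ?_ h7
  rw [hsq]
  rcases le_total (ε / 2) (g 0) with h | h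
  · nlinarith [mul_le_mul h h4 hε.le h0, mul_nonneg h1 h2]
  · have h' : ε / 2 ≤ g 1 := by linarith
    nlinarith [mul_le_mul h' h5 hε.le h1, mul_nonneg h0 h2]

theorem GammaEps_subset_Gamma (hε : 0 < ε) : GammaEps ε ⊆ Gamma := by
  intro g hg
  have h := GammaEps.le_kappa hε hg
  obtain ⟨⟨h0, -⟩, ⟨h1, -⟩, ⟨h2, -⟩, h3, -⟩ := hg
  exact ⟨h0, h1, h2, h3, by linarith⟩

theorem abs_sub_le_rhoGamma (g h : Fin 4 → ℝ) : |g 0 - h 0| ≤ rhoGamma g h ∧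
    |g 1 - h 1| ≤ rhoGamma g h ∧ |g 2 - h 2| ≤ rhoGamma g h := by
  refine ⟨?_, ?_, ?_⟩ <;>
  · apply Real.abs_le_sqrt
    nlinarith [sq_nonneg (g 0 - h 0), sq_nonneg (g 1 - h 1), sq_nonneg (g 2 - h 2)]

theorem abs_mul_sub_mul_le {a b a' b' e ρ : ℝ} (hb : 0 ≤ b) (hbe : b ≤ e) (ha' : 0 ≤ a')
    (hae : a' ≤ e) (h1 : |a - a'| ≤ ρ) (h2 : |b - b'| ≤ ρ) : |a * b - a' * b'| ≤ 2 * e * ρ := by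
  have e1 : a * b - a' * b' = (a - a') * b + a' * (b - b') := by ring
  have hρ : 0 ≤ ρ := (abs_nonneg _).trans h1
  rw [e1]
  refine (abs_add_le _ _).trans ?_
  rw [abs_mul, abs_mul, abs_of_nonneg hb, abs_of_nonneg ha']
  nlinarith [mul_le_mul h1 hbe hb hρ, mul_le_mul hae h2 (abs_nonneg _) (ha'.trans hae)]

theorem abs_kappa_sub_le (hε : 0 < ε) (hg : g ∈ GammaEps ε) (hh : h ∈ GammaEps ε) :
    |g 3 - h 3| ≤ 6 * ε⁻¹ ^ 2 * rhoGamma g h := by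
  obtain ⟨r0, r1, r2⟩ := abs_sub_le_rhoGamma g h
  have k1 := GammaEps.le_kappa hε hg
  have k2 := GammaEps.le_kappa hε hh
  have s1 := GammaEps.sq_eq hg
  have s2 := GammaEps.sq_eq hh
  obtain ⟨⟨g0, g0'⟩, ⟨g1, g1'⟩, ⟨g2, g2'⟩, -⟩ := hg
  obtain ⟨⟨h0, h0'⟩, ⟨h1, h1'⟩, ⟨h2, h2'⟩, -⟩ := hh
  have m1 := abs_mul_sub_mul_le g2 g2' h1 h1' r1 r2
  have m2 := abs_mul_sub_mul_le g0 g0' h2 h2' r2 r0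
  have m3 := abs_mul_sub_mul_le g1 g1' h0 h0' r0 r1
  have e1 : |(g 3 - h 3) * (g 3 + h 3)| ≤ 6 * ε⁻¹ * rhoGamma g h := by
    have : (g 3 - h 3) * (g 3 + h 3) = (g 1 * g 2 - h 1 * h 2) + (g 2 * g 0 - h 2 * h 0) +
        (g 0 * g 1 - h 0 * h 1) := by linear_combination s1 - s2
    rw [this]
    refine (abs_add_three _ _ _).trans ?_
    linarith
  rw [abs_mul, abs_of_pos (by linarith : 0 < g 3 + h 3)] at e1
  have e2 : |g 3 - h 3| * ε ≤ 6 * ε⁻¹ * rhoGamma g h := by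
    nlinarith [abs_nonneg (g 3 - h 3)]
  rw [← le_div_iff₀ hε] at e2
  refine e2.trans (le_of_eq ?_)
  field_simp

theorem abs_poleForm_sub_le {z : ℂ} {ρ K : ℝ} (h0 : |g 0 - h 0| ≤ ρ) (h1 : |g 1 - h 1| ≤ ρ)
    (h2 : |g 2 - h 2| ≤ ρ) (h3 : |g 3 - h 3| ≤ K) :
    |poleForm z g - poleForm z h| ≤ (3 * ρ + K) * (1 + Complex.normSq z) := by
  have hρ : 0 ≤ ρ := (abs_nonneg _).trans h0
  have hK : 0 ≤ K := (abs_nonneg _).trans h3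
  have e : poleForm z g - poleForm z h = ((g 0 - h 0) * Complex.normSq z +
      (g 2 - h 2) * Complex.normSq z + 2 * ((g 3 - h 3) * z.re)) +
      -(2 * ((g 2 - h 2) * z.im)) + ((g 1 - h 1) + (g 2 - h 2)) := by
    unfold poleForm; ring
  have hN := Complex.normSq_nonneg z
  have hx : 2 * |z.re| ≤ 1 + Complex.normSq z := by
    rw [Complex.normSq_apply, ← abs_mul_abs_self z.re]
    nlinarith [sq_nonneg (|z.re| - 1), mul_self_nonneg z.im]
  have hy : 2 * |z.im| ≤ 1 + Complex.normSq z := by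
    rw [Complex.normSq_apply, ← abs_mul_abs_self z.im]
    nlinarith [sq_nonneg (|z.im| - 1), mul_self_nonneg z.re]
  rw [e]
  refine (abs_add_three _ _ _).trans ?_
  have a1 := abs_add_three ((g 0 - h 0) * Complex.normSq z) ((g 2 - h 2) * Complex.normSq z)
    (2 * ((g 3 - h 3) * z.re))
  have a2 := abs_add_le (g 1 - h 1) (g 2 - h 2)
  rw [abs_mul, abs_mul, abs_mul, abs_mul, abs_of_nonneg hN, abs_two] at a1
  have a3 : |-(2 * ((g 2 - h 2) * z.im))| = 2 * (|g 2 - h 2| * |z.im|) := by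
    rw [abs_neg, abs_mul, abs_mul, abs_two]
  have b1 := mul_le_mul_of_nonneg_right h0 hN
  have b2 := mul_le_mul_of_nonneg_right h2 hN
  have b3 := mul_le_mul h3 hx (by positivity) hK
  have b4 := mul_le_mul h2 hy (by positivity) hρ
  linarith

theorem one_add_normSq_le_poleForm (hε : 0 < ε) (hε1 : ε < 1) (hh : h ∈ GammaEps ε) {z : ℂ}
    (hz : 0 ≤ z.re) : 1 + Complex.normSq z ≤ 26 * ε⁻¹ ^ 5 * poleForm z h := by
  have k := GammaEps.le_kappa hε hh
  have sq := GammaEps.sq_eq hh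
  obtain ⟨⟨h0, h0'⟩, ⟨h1, h1'⟩, ⟨h2, h2'⟩, -, -, hn, -⟩ := hh
  set e := ε⁻¹ with he
  have hee : ε * e = 1 := mul_inv_cancel₀ hε.ne'
  have he1 : 1 ≤ e := (one_lt_inv₀ hε).2 hε1 |>.le
  set n := h 0 + h 2 with hndef
  have hnpos : 0 < n := by linarith
  have form : n * poleForm z h = (n * z.re + h 3) ^ 2 + (n * z.im - h 2) ^ 2 := by
    rw [poleForm, Complex.normSq_apply, ← hndef]
    linear_combination (-1) * sq + (h 1 + h 2) * hndef
  have f1 : n ^ 2 * Complex.normSq z ≤ 2 * (n * poleForm z h) + 2 * h 2 ^ 2 := by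
    rw [form, Complex.normSq_apply]
    nlinarith [sq_nonneg (n * z.im - 2 * h 2), sq_nonneg (n * z.re),
      mul_nonneg (mul_nonneg hnpos.le hz) (by linarith : 0 ≤ h 3), sq_nonneg (h 3)]
  have f2 : h 3 ^ 2 ≤ n * poleForm z h := by
    rw [form]
    nlinarith [sq_nonneg (n * z.im - h 2), sq_nonneg (n * z.re),
      mul_nonneg (mul_nonneg hnpos.le hz) (by linarith : 0 ≤ h 3)]
  have f3 : 1 ≤ 4 * e ^ 2 * (n * poleForm z h) := by
    have : 1 / 2 ≤ e * h 3 := by nlinarith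
    nlinarith [sq_nonneg e]
  have hP : 0 < n * poleForm z h := by
    have : 0 < h 3 := by linarith
    exact lt_of_lt_of_le (by positivity) f2
  have hP' : 0 < poleForm z h := by
    by_contra! hc
    nlinarith
  have hne : n ≤ 2 * e := by rw [hndef]; linarith
  have f4 : n ^ 2 + 2 * h 2 ^ 2 ≤ 6 * e ^ 2 := by nlinarith
  have f5 : n ^ 2 * (1 + Complex.normSq z) ≤ 26 * e ^ 4 * (n * poleForm z h) := by
    have g1 : 6 * e ^ 2 ≤ 24 * (e ^ 4 * (n * poleForm z h)) :=
      (le_mul_of_one_le_right (by positivity) f3).trans_eq (by ring)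
    have g2 : 1 ≤ e ^ 4 := one_le_pow₀ he1
    have g3 := mul_le_mul_of_nonneg_right g2 hP.le
    rw [mul_add, mul_one, mul_assoc 26]
    linarith
  have f6 : n * (1 + Complex.normSq z) ≤ 26 * e ^ 4 * poleForm z h := by
    refine le_of_mul_le_mul_left ?_ hnpos
    linarith
  have f7 : 1 ≤ e * n := by nlinarith
  have hN := Complex.normSq_nonneg z
  calc 1 + Complex.normSq z ≤ e * n * (1 + Complex.normSq z) :=
        le_mul_of_one_le_left (by positivity) f7
    _ = e * (n * (1 + Complex.normSq z)) := by ring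
    _ ≤ e * (26 * e ^ 4 * poleForm z h) := mul_le_mul_of_nonneg_left f6 (by positivity)
    _ = 26 * e ^ 5 * poleForm z h := by ring

theorem poleForm_le_exp_mul (hε : 0 < ε) (hε1 : ε < 1) (hg : g ∈ GammaEps ε)
    (hh : h ∈ GammaEps ε) {z : ℂ} (hz : 0 ≤ z.re) :
    poleForm z g ≤ Real.exp (234 * ε⁻¹ ^ 7 * rhoGamma g h) * poleForm z h := by
  obtain ⟨r0, r1, r2⟩ := abs_sub_le_rhoGamma g h
  have h1 := abs_poleForm_sub_le (z := z) r0 r1 r2 (abs_kappa_sub_le hε hg hh)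
  have h2 := one_add_normSq_le_poleForm hε hε1 hh hz
  have hρ : 0 ≤ rhoGamma g h := Real.sqrt_nonneg _
  have hN := Complex.normSq_nonneg z
  set e := ε⁻¹ with he
  have he1 : 1 ≤ e := (one_lt_inv₀ hε).2 hε1 |>.le
  have hP : 0 ≤ poleForm z h := by
    have : 0 < 26 * e ^ 5 := by positivity
    by_contra! hc
    nlinarith
  have h3 : 3 * rhoGamma g h + 6 * e ^ 2 * rhoGamma g h ≤ 9 * e ^ 2 * rhoGamma g h := by
    have : 1 ≤ e ^ 2 := one_le_pow₀ he1
    nlinarith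
  have h4 : poleForm z g - poleForm z h ≤ 234 * e ^ 7 * rhoGamma g h * poleForm z h := by
    calc poleForm z g - poleForm z h ≤ _ := le_abs_self _
      _ ≤ _ := h1
      _ ≤ 9 * e ^ 2 * rhoGamma g h * (26 * e ^ 5 * poleForm z h) :=
        mul_le_mul h3 h2 (by positivity) (by positivity)
      _ = _ := by ring
  have h5 := Real.add_one_le_exp (234 * e ^ 7 * rhoGamma g h)
  nlinarith

theorem poleForm_vecMul_Mword_le (hε : 0 < ε) (hε1 : ε < 1) (hg : g ∈ GammaEps ε)
    (hh : h ∈ GammaEps ε) (w : Word) {z : ℂ} (hz : 0 ≤ z.re) :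
    poleForm z (g ᵥ* Mword w) ≤
      Real.exp (234 * ε⁻¹ ^ 7 * rhoGamma g h) * poleForm z (h ᵥ* Mword w) := by
  obtain ⟨c, z', hc, hz', e⟩ := poleForm_vecMul_Mword w hz
  rw [e, e, mul_left_comm]
  exact mul_le_mul_of_nonneg_left (poleForm_le_exp_mul hε hε1 hg hh hz') hc.le

end

theorem poleForm_pos {g : Fin 4 → ℝ} (hg : g ∈ Gamma) {z : ℂ} (hz : 0 ≤ z.re) :
    0 < poleForm z g := by
  rw [poleForm_eq z hg]
  exact mul_pos (Gamma.add_pos hg)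
    (Complex.normSq_pos.2 (sub_ne_zero.2 (ne_of_re_nonneg (isPole_poleOf hg) hz)))

theorem norm_mob_sub_mob_sq {g : Fin 4 → ℝ} (hg : g ∈ Gamma) (A : ℂ) {B : ℂ}
    (hB : ‖B‖ = 2 / (g 0 + g 2)) {z w : ℂ} (hz : 0 ≤ z.re) (hw : 0 ≤ w.re) :
    ‖mob A B (poleOf g) z - mob A B (poleOf g) w‖ ^ 2 * (poleForm z g * poleForm w g) =
      4 * ‖w - z‖ ^ 2 := by
  have hn := Gamma.add_pos hg
  have hzp := ne_of_re_nonneg (isPole_poleOf hg) hz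
  have hwp := ne_of_re_nonneg (isPole_poleOf hg) hw
  have h1 := norm_pos_iff.2 (sub_ne_zero.2 hzp)
  have h2 := norm_pos_iff.2 (sub_ne_zero.2 hwp)
  rw [mob_sub_mob A _ hzp hwp, poleForm_eq z hg, poleForm_eq w hg, norm_div, norm_mul, norm_mul,
    hB, Complex.normSq_eq_norm_sq, Complex.normSq_eq_norm_sq]
  field_simp
  ring

theorem hausdorffMeasure_AG_sdiff_singleton {d : ℝ} (hd : 0 < d) (𝒟 : Fin 3 → Set ℂ) (A : ℂ) :
    μH[d] (AG 𝒟 \ {A}) = μH[d] (AG 𝒟) := by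
  have := MeasureTheory.Measure.nullSingletonClass_hausdorff ℂ hd
  exact measure_sdiff_null (measure_singleton A)

theorem hausdorffMeasure_AG_tripleOf_le {d : ℝ} (hd : 0 < d) {g h : Fin 4 → ℝ}
    (hg : g ∈ Gamma) (hh : h ∈ Gamma) {c : ℝ}
    (hc : ∀ z : ℂ, 0 ≤ z.re → poleForm z g ≤ Real.exp c * poleForm z h) :
    μH[d] (AG (tripleOf h)) ≤ ENNReal.ofReal (Real.exp (c * d)) * μH[d] (AG (tripleOf g)) := by
  obtain ⟨A₁, B₁, hB₁, e₁⟩ := exists_tripleOf_eq hg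
  obtain ⟨A₂, B₂, hB₂, e₂⟩ := exists_tripleOf_eq hh
  have hne₁ : B₁ ≠ 0 := norm_pos_iff.1 (hB₁ ▸ div_pos two_pos (Gamma.add_pos hg))
  have hne₂ : B₂ ≠ 0 := norm_pos_iff.1 (hB₂ ▸ div_pos two_pos (Gamma.add_pos hh))
  have hp₁ := isPole_poleOf hg
  have hp₂ := isPole_poleOf hh
  rw [e₁, e₂, ← hausdorffMeasure_AG_sdiff_singleton hd (stdTriple A₁ _ _) A₁,
    ← hausdorffMeasure_AG_sdiff_singleton hd (stdTriple A₂ _ _) A₂, AG_stdTriple hne₁ hp₁, AG_stdTriple hne₂ hp₂]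
  set F : ℂ → ℂ := fun v => mob A₂ B₂ (poleOf h) (mobInv A₁ B₁ (poleOf g) v)
  have hF : ∀ z : ℂ, 0 ≤ z.re → F (mob A₁ B₁ (poleOf g) z) = mob A₂ B₂ (poleOf h) z := by
    intro z hz
    simp only [F]
    rw [mobInv_mob _ _ hne₁ (ne_of_re_nonneg hp₁ hz)]
  have himg : mob A₂ B₂ (poleOf h) '' refGasket = F '' (mob A₁ B₁ (poleOf g) '' refGasket) := by
    rw [Set.image_image]
    exact Set.image_congr fun z hz => (hF z (refGasket_re_nonneg hz)).symm
  have hlip : LipschitzOnWith (Real.exp c).toNNReal F (mob A₁ B₁ (poleOf g) '' refGasket) := by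
    refine LipschitzOnWith.of_dist_le_mul ?_
    rintro _ ⟨z, hz, rfl⟩ _ ⟨w, hw, rfl⟩
    have hz := refGasket_re_nonneg hz
    have hw := refGasket_re_nonneg hw
    rw [hF z hz, hF w hw, Real.coe_toNNReal _ (Real.exp_pos _).le, dist_eq_norm, dist_eq_norm]
    have n₁ := norm_mob_sub_mob_sq hg A₁ hB₁ hz hw
    have n₂ := norm_mob_sub_mob_sq hh A₂ hB₂ hz hw
    have pz := poleForm_pos hh hz
    have pw := poleForm_pos hh hw
    refine le_of_sq_le_sq ?_ (by positivity)
    refine le_of_mul_le_mul_right ?_ (mul_pos pz pw)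
    rw [n₂, ← n₁, mul_pow, mul_comm (Real.exp c ^ 2), mul_assoc]
    refine mul_le_mul_of_nonneg_left ?_ (sq_nonneg _)
    exact (mul_le_mul (hc z hz) (hc w hw) (poleForm_pos hg hw).le (by positivity)).trans_eq
      (by ring)
  rw [himg]
  refine (hlip.hausdorffMeasure_image_le hd.le).trans_eq ?_
  congr 1
  change (ENNReal.ofReal _) ^ d = _
  rw [ENNReal.ofReal_rpow_of_pos (Real.exp_pos _), Real.exp_mul]

theorem ENNReal.abs_log_toReal_sub_log_toReal_le {a b : ℝ≥0∞} {c : ℝ} (hc : 0 ≤ c)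
    (hab : a ≤ ENNReal.ofReal (Real.exp c) * b) (hba : b ≤ ENNReal.ofReal (Real.exp c) * a) :
    |Real.log a.toReal - Real.log b.toReal| ≤ c := by
  have key : ∀ {a b : ℝ≥0∞}, a ≠ 0 → b ≠ ∞ → a ≤ ENNReal.ofReal (Real.exp c) * b →
      Real.log a.toReal - Real.log b.toReal ≤ c := by
    intro a b ha hb h
    have hfin : ENNReal.ofReal (Real.exp c) * b ≠ ∞ := ENNReal.mul_ne_top ENNReal.ofReal_ne_top hb
    have ha' : 0 < a.toReal := ENNReal.toReal_pos ha (h.trans_lt hfin.lt_top).ne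
    have h' := ENNReal.toReal_mono hfin h
    rw [ENNReal.toReal_mul, ENNReal.toReal_ofReal (Real.exp_pos _).le] at h'
    have hb' : 0 < b.toReal := pos_of_mul_pos_right (ha'.trans_le h') (Real.exp_pos _).le
    have := Real.log_le_log ha' h'
    rw [Real.log_mul (Real.exp_pos _).ne' hb'.ne', Real.log_exp] at this
    linarith
  by_cases ha : a = 0
  · have hb : b = 0 := by simpa [ha] using hba
    simpa [ha, hb] using hc
  by_cases hb : b = ∞
  · have ha : a = ∞ := by
      by_contra ha
      exact (ENNReal.mul_ne_top ENNReal.ofReal_ne_top ha) (top_le_iff.1 (hb ▸ hba))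
    simpa [ha, hb] using hc
  have hb0 : b ≠ 0 := by
    rintro rfl
    simp at hab
    exact ha hab
  have ha' : a ≠ ∞ := (hab.trans_lt (ENNReal.mul_ne_top ENNReal.ofReal_ne_top hb).lt_top).ne
  rw [abs_le]
  constructor
  · linarith [key hb0 ha' hba]
  · exact key ha hb hab

theorem rhoGamma_comm (g h : Fin 4 → ℝ) : rhoGamma g h = rhoGamma h g := by
  unfold rhoGamma
  congr 1
  ring

theorem abs_log_HGamma_sub_le (hd : 0 < dAG) {ε : ℝ} (hε : 0 < ε) (hε1 : ε < 1)
    {g h : Fin 4 → ℝ} (hg : g ∈ GammaEps ε) (hh : h ∈ GammaEps ε) (w : Word) :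
    |Real.log (HGamma (g ᵥ* Mword w)) - Real.log (HGamma (h ᵥ* Mword w))| ≤
      234 * ε⁻¹ ^ 7 * rhoGamma g h * dAG := by
  have hg' := vecMul_Mword_mem_Gamma w (GammaEps_subset_Gamma hε hg)
  have hh' := vecMul_Mword_mem_Gamma w (GammaEps_subset_Gamma hε hh)
  have hρ : 0 ≤ rhoGamma g h := Real.sqrt_nonneg _
  refine ENNReal.abs_log_toReal_sub_log_toReal_le (by positivity) ?_ ?_
  · refine hausdorffMeasure_AG_tripleOf_le hd hh' hg' fun z hz => ?_
    rw [rhoGamma_comm g h]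
    exact poleForm_vecMul_Mword_le hε hε1 hh hg w hz
  · exact hausdorffMeasure_AG_tripleOf_le hd hg' hh' fun z hz =>
      poleForm_vecMul_Mword_le hε hε1 hg hh w hz

theorem ball_half_eq_gdisk (A b : ℂ) {c : ℝ} (hc : Complex.normSq b - 1 * c = (1 / 2) ^ 2) :
    gdisk A 1 b c = Metric.ball (A - b) (1 / 2) := by
  rw [gdisk_eq_ball A one_pos one_half_pos hc]
  simp

theorem baseTriple_eq_stdTriple :
    baseTriple = stdTriple (1 / 2 + Complex.I) (-1) (-1 + Complex.I) := by
  funext k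
  fin_cases k
  · ext v
    simp [baseTriple, stdTriple, gdisk]
    constructor <;> intro h <;> linarith
  · change Metric.ball (Complex.I / 2 - 1 / 2) (1 / 2) =
      gdisk (1 / 2 + Complex.I) (Complex.normSq (-1 + Complex.I) - (-1 + Complex.I).im)
        (((starRingEnd ℂ) (-1 + Complex.I) + Complex.I / 2) * (-1)) (Complex.normSq (-1))
    have e : Complex.normSq (-1 + Complex.I) - (-1 + Complex.I).im = 1 := by
      simp [Complex.normSq_apply]
    rw [e, ball_half_eq_gdisk]
    · congr 1
      simp
      ring
    · simp [Complex.normSq_apply]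
      norm_num
  · change Metric.ball (Complex.I / 2 + 1 / 2) (1 / 2) =
      gdisk (1 / 2 + Complex.I) (-1 + Complex.I).im (-(Complex.I * (-1) / 2)) 0
    have e : (-1 + Complex.I).im = 1 := by simp
    rw [e, ball_half_eq_gdisk]
    · congr 1
      ring
    · simp [Complex.normSq_apply]
      norm_num

theorem isPole_neg_one_add_I : IsPole (-1 + Complex.I) := by
  refine ⟨⟨?_, ?_, ?_, ?_⟩, ?_⟩ <;> norm_num [Complex.normSq_apply]

theorem cuspMap_im_lt_one {s z : ℂ} (hs : s.re = 0) (hs' : s = 0 ∨ s = Complex.I)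
    (hz : 0 ≤ z.re) (hz1 : z.im < 1) : (cuspMap s z).im < 1 := by
  have hne : z - s + 1 ≠ 0 := by
    intro h
    have := congrArg Complex.re h
    simp [hs] at this
    linarith
  have hN := Complex.normSq_pos.2 hne
  obtain ⟨-, e⟩ := normSq_cuspMap hne
  refine lt_of_mul_lt_mul_left ?_ hN.le
  rw [e]
  rcases hs' with rfl | rfl
  · rw [Complex.normSq_apply]
    simp
    nlinarith [sq_nonneg (z.im - 1 / 2)]
  · simp
    linarith

theorem refMap_im_lt_one (j : Fin 3) {z : ℂ} (hz : 0 ≤ z.re) (hz1 : z.im < 1) :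
    (refMap j z).im < 1 := by
  fin_cases j
  · exact cuspMap_im_lt_one rfl (Or.inl rfl) hz hz1
  · change (z + 1).im < 1
    simpa using hz1
  · exact cuspMap_im_lt_one rfl (Or.inr rfl) hz hz1

theorem refDisk_im_lt_one (w : Word) {z : ℂ} (hz : z ∈ refDisk w) : z.im < 1 := by
  induction w generalizing z with
  | nil =>
    have hz' : Complex.normSq (z - 1) < z.im := hz
    rw [Complex.normSq_apply] at hz'
    by_contra! h
    nlinarith [mul_self_nonneg (z - 1).re, (by simp : (z - 1).im = z.im)]
  | cons j w ih =>
    obtain ⟨y, hy, rfl⟩ := hz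
    exact refMap_im_lt_one j (refDisk_re_nonneg w hy) (ih hy)

theorem ofReal_add_I_mem_refGasket {x : ℝ} (hx : 1 ≤ x) : (x + Complex.I : ℂ) ∈ refGasket := by
  refine ⟨?_, ?_⟩
  · have ht : Tendsto (fun t : ℝ => (x + t * Complex.I : ℂ)) (𝓝[<] 1) (𝓝 (x + Complex.I)) := by
      have : Continuous fun t : ℝ => (x + t * Complex.I : ℂ) := by fun_prop
      have h := (this.tendsto 1).mono_left (nhdsWithin_le_nhds (s := Set.Iio 1))
      simpa using h
    refine mem_closure_of_tendsto ht ?_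
    filter_upwards [Ioo_mem_nhdsLT (zero_lt_one' ℝ)] with t ht
    rw [mem_rightRegion]
    have h0 := ht.1
    have h1 := ht.2
    refine ⟨by simp; linarith, by simpa using h0, by simpa using h1, ?_⟩
    rw [Complex.normSq_apply]
    simp
    nlinarith [mul_self_nonneg t]
  · simp only [Set.mem_iUnion, not_exists]
    intro w hw
    have := refDisk_im_lt_one w hw
    simp at this

theorem one_le_dimH_AG_baseTriple : 1 ≤ dimH (AG baseTriple) := by
  have hsub : Set.Ioo (0 : ℝ) (1 / 2) ⊆ Complex.re '' AG baseTriple := by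
    intro t ht
    have ht1 := ht.1
    have ht2 : 0 < 1 / 2 - t := sub_pos.2 ht.2
    have hx : (1 : ℝ) ≤ 1 / (1 / 2 - t) - 1 := by
      rw [le_sub_iff_add_le, le_div_iff₀ ht2]
      linarith
    have hmem := Set.mem_image_of_mem (mob (1 / 2 + Complex.I) (-1) (-1 + Complex.I))
      (ofReal_add_I_mem_refGasket hx)
    rw [← AG_stdTriple (neg_ne_zero.2 one_ne_zero) isPole_neg_one_add_I,
      ← baseTriple_eq_stdTriple] at hmem
    refine ⟨_, hmem.1, ?_⟩
    have e : ((1 / (1 / 2 - t) - 1 : ℝ) + Complex.I : ℂ) - (-1 + Complex.I) =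
        ((1 / (1 / 2 - t) : ℝ) : ℂ) := by
      push_cast
      ring
    have e' : ((1 / 2 : ℂ) + Complex.I + -1 / ((1 / (1 / 2 - t) : ℝ) : ℂ)) =
        ((t : ℝ) : ℂ) + Complex.I := by
      push_cast
      rw [div_div_eq_mul_div]
      ring
    rw [mob, e, e']
    simp
  have hre : LipschitzWith 1 Complex.re :=
    LipschitzWith.of_dist_le_mul fun z w => by
      rw [NNReal.coe_one, one_mul, Real.dist_eq, dist_eq_norm, ← Complex.sub_re]
      exact Complex.abs_re_le_norm _
  calc (1 : ℝ≥0∞) = dimH (Set.Ioo (0 : ℝ) (1 / 2)) := by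
        rw [Real.dimH_of_nonempty_interior, Module.finrank_self, Nat.cast_one]
        rw [interior_Ioo]
        exact Set.nonempty_Ioo.2 one_half_pos
    _ ≤ dimH (Complex.re '' AG baseTriple) := dimH_mono hsub
    _ ≤ dimH (AG baseTriple) := hre.dimH_image_le _

theorem one_le_dAG : 1 ≤ dAG := by
  rw [dAG, ← ENNReal.toReal_one]
  exact ENNReal.toReal_mono (Real.dimH_ne_top _) one_le_dimH_AG_baseTriple

/-- Lipschitz estimate for `log ℋ_Γ(gM_w)`. -/
theorem log_HGamma_Mword_lipschitz :
    ∃ c₄ : ℝ, 0 < c₄ ∧ ∀ ε : ℝ, ε ∈ Set.Ioo (0:ℝ) 1 →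
      ∀ g₁ ∈ GammaEps ε, ∀ g₂ ∈ GammaEps ε, ∀ w : Word,
        |Real.log (HGamma (Matrix.vecMul g₁ (Mword w))) -
          Real.log (HGamma (Matrix.vecMul g₂ (Mword w)))| ≤
          c₄ * ε ^ (1 - 45 * dAG) * rhoGamma g₁ g₂ := by
  have hd := one_le_dAG
  refine ⟨234 * dAG, by positivity, ?_⟩
  rintro ε ⟨hε, hε1⟩ g₁ hg₁ g₂ hg₂ w
  refine (abs_log_HGamma_sub_le (by positivity) hε hε1 hg₁ hg₂ w).trans ?_
  have hpow : ε⁻¹ ^ 7 ≤ ε ^ (1 - 45 * dAG) := by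
    have h := Real.rpow_le_rpow_of_exponent_ge hε hε1.le (by linarith : 1 - 45 * dAG ≤ -7)
    rwa [Real.rpow_neg hε.le, ← Nat.cast_ofNat, Real.rpow_natCast, ← inv_pow] at h
  have hρ : 0 ≤ rhoGamma g₁ g₂ := Real.sqrt_nonneg _
  calc 234 * ε⁻¹ ^ 7 * rhoGamma g₁ g₂ * dAG = 234 * dAG * ε⁻¹ ^ 7 * rhoGamma g₁ g₂ := by ring
    _ ≤ 234 * dAG * ε ^ (1 - 45 * dAG) * rhoGamma g₁ g₂ := by gcongr
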